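/- arXiv:1708.04635 — 3 statements merged into one kernel-verified Lean document; each statement's English description precedes it below -/
import Mathlib

section
/- Let R be a commutative ring, N a Noetherian R-module, and I an ideal of R that is integrally closed relative to N, i.e. I = I^{(N)}_a. Then I admits a primary decomposition I = q_1 ∩ ⋯ ∩ q_t in which every primary component q_i is integrally closed relative to N, i.e. q_i = (q_i)^{(N)}_a for all i. -/
open Pointwise

section Defs

variable {R : Type} [CommRing R]

/-- `x` is integrally dependent on the ideal `I` relative to the module `N`:
`x ^ n • N ⊆ ∑_{i=1}^n x^(n-i) • (I^i • N)` for some `n ≥ 1`. -/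
def Ideal.RelIntDep (I : Ideal R) (N : Type) [AddCommGroup N] [Module R N] (x : R) : Prop :=
  ∃ n : ℕ, 0 < n ∧ ∀ m : N, x ^ n • m ∈
    ⨆ i ∈ Finset.Icc 1 n, x ^ (n - i) • (I ^ i • (⊤ : Submodule R N))

/-- The integral closure `I^{(N)}_a` of `I` relative to `N`, as a subset of `R`. -/
def Ideal.relIntClosure (I : Ideal R) (N : Type) [AddCommGroup N] [Module R N] : Set R :=
  {x | I.RelIntDep N x}

/-- The classical integral closure `I_a` of an ideal, as a subset of `R`. -/
def Ideal.intClosure (I : Ideal R) : Set R :=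
  {x | ∃ n : ℕ, 0 < n ∧ ∃ r : ℕ → R, (∀ i ∈ Finset.Icc 1 n, r i ∈ I ^ i) ∧
    x ^ n + ∑ i ∈ Finset.Icc 1 n, r i * x ^ (n - i) = 0}

/-- `mAss_R N`: the set of minimal members of `Ass_R N`. -/
def mAss (R : Type) [CommRing R] (N : Type) [AddCommGroup N] [Module R N] : Set (Ideal R) :=
  {p | Minimal (· ∈ associatedPrimes R N) p}

/-- `Ass_R (R/J)` for a subset `J ⊆ R`: primes of the form `(J :_R x)`. -/
def assQuot (J : Set R) : Set (Ideal R) :=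
  {p | p.IsPrime ∧ ∃ x : R, (p : Set R) = {r : R | r * x ∈ J}}

/-- `Ass_R (J/K)` for subsets `K ⊆ J` of `R`: primes of the form `(K :_R x)` with `x ∈ J`. -/
def assQuot₂ (J K : Set R) : Set (Ideal R) :=
  {p | p.IsPrime ∧ ∃ x ∈ J, (p : Set R) = {r : R | r * x ∈ K}}

/-- `S(J) = ∪_{s ∈ S} (J :_R s)`. -/
def sat (S : Set R) (J : Set R) : Set R := {x | ∃ s ∈ S, s * x ∈ J}

/-- `(J :_R K)` for subsets of `R`. -/
def setColon (J K : Set R) : Set R := {x | ∀ y ∈ K, x * y ∈ J}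

/-- `(J :_R ⟨K⟩) = ∪_{n ≥ 1} (J :_R K^n)`. -/
def colonPow (J : Set R) (K : Ideal R) : Set R :=
  {x | ∃ n : ℕ, 0 < n ∧ ∀ y ∈ K ^ n, x * y ∈ J}

end Defs

namespace Ideal

variable {A B : Type} [CommRing A] [CommRing B]

/-- An ideal is integrally closed when it contains every `y` for which it is a reduction of the
ideal obtained by adjoining `y`. -/
def IsIntClosed (I : Ideal A) : Prop :=
  ∀ (y : A) (n : ℕ), y ^ (n + 1) ∈ I * (I ⊔ span {y}) ^ n → y ∈ I

lemma map_comap_mul_pow_le (f : A →+* B) (I : Ideal B) (y : A) (n : ℕ) :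
    (I.comap f * (I.comap f ⊔ span {y}) ^ n).map f ≤ I * (I ⊔ span {f y}) ^ n := by
  rw [Ideal.map_mul, Ideal.map_pow, Ideal.map_sup, map_span, Set.image_singleton]
  exact mul_mono map_comap_le (pow_right_mono (sup_le_sup_right map_comap_le _) n)

lemma IsIntClosed.comap {I : Ideal B} (hI : I.IsIntClosed) (f : A →+* B) :
    (I.comap f).IsIntClosed := fun y n hy =>
  hI (f y) n (map_pow f y _ ▸ map_comap_mul_pow_le f I y n (mem_map_of_mem f hy))

lemma sup_pow_succ_le (I J : Ideal A) (n : ℕ) :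
    (I ⊔ J) ^ (n + 1) ≤ I * (I ⊔ J) ^ n ⊔ J ^ (n + 1) := by
  induction n with
  | zero => simp
  | succ n ih =>
    calc (I ⊔ J) ^ (n + 1 + 1) = (I ⊔ J) ^ (n + 1) * I ⊔ (I ⊔ J) ^ (n + 1) * J := by
          rw [pow_succ _ (n + 1), Ideal.mul_sup]
      _ ≤ I * (I ⊔ J) ^ (n + 1) ⊔ (I * (I ⊔ J) ^ (n + 1) ⊔ J ^ (n + 1 + 1)) := by
          refine sup_le_sup (mul_comm _ _).le ((mul_mono_left ih).trans ?_)
          rw [Ideal.sup_mul, mul_assoc, ← pow_succ J]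
          refine sup_le_sup_right (mul_mono_right ?_) _
          rw [pow_succ]
          exact mul_mono_right le_sup_right
      _ = _ := by rw [← sup_assoc, sup_idem]

lemma sup_span_pow_succ_le {I : Ideal A} {y : A} {n : ℕ}
    (hy : y ^ (n + 1) ∈ I * (I ⊔ span {y}) ^ n) :
    (I ⊔ span {y}) ^ (n + 1) ≤ I * (I ⊔ span {y}) ^ n := by
  refine (sup_pow_succ_le _ _ _).trans (sup_le le_rfl ?_)
  rwa [span_singleton_pow, span_singleton_le_iff_mem]

lemma isIntClosed_span_singleton [IsDomain A] [IsIntegrallyClosed A] {g : A} (hg : g ≠ 0) :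
    (span {g}).IsIntClosed := by
  intro y n hy
  set J := span {g} ⊔ span {y}
  have hle := sup_span_pow_succ_le hy
  let F := FractionRing A
  have hgF : algebraMap A F g ≠ 0 := by simpa using hg
  have hgJ : g ∈ J := mem_sup_left (mem_span_singleton_self g)
  have hyJ : y ∈ J := mem_sup_right (mem_span_singleton_self y)
  have hfg : J.FG := (Submodule.fg_span_singleton g).sup (Submodule.fg_span_singleton y)
  have hint : IsIntegral A (algebraMap A F y / algebraMap A F g) := by
    refine isIntegral_of_smul_mem_submodule (M := F)
      (Submodule.map (Algebra.linearMap A F) (J ^ n)) ?_ (Submodule.FG.map _ (FG.pow hfg)) _ ?_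
    · rw [Submodule.ne_bot_iff]
      exact ⟨_, Submodule.mem_map_of_mem (pow_mem_pow hgJ n), by simpa using pow_ne_zero n hg⟩
    · rintro _ ⟨j, hj, rfl⟩
      have h : j * y ∈ span {g} * J ^ n := hle (by rw [pow_succ]; exact mul_mem_mul hj hyJ)
      obtain ⟨k, hk, hkj⟩ := mem_span_singleton_mul.mp h
      refine ⟨k, hk, ?_⟩
      have := congrArg (algebraMap A F) hkj
      simp only [map_mul] at this
      simp only [Algebra.linearMap_apply, smul_eq_mul]
      rw [div_mul_eq_mul_div, eq_div_iff hgF]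
      linear_combination this
  obtain ⟨w, hw⟩ := IsIntegrallyClosed.isIntegral_iff.mp hint
  rw [mem_span_singleton]
  refine ⟨w, IsFractionRing.injective A F ?_⟩
  rw [map_mul, hw, mul_div_cancel₀ _ hgF]

lemma _root_.exists_isIntegrallyClosed_of_isDomain (E : Type) [CommRing E] [IsDomain E] :
    ∃ (O : Type) (_ : CommRing O) (_ : IsDomain O) (_ : IsIntegrallyClosed O) (φ : E →+* O),
      Function.Injective φ ∧ IsLocalHom φ := by
  have hinj : Function.Injective (algebraMap E (integralClosure E (FractionRing E))) := by
    refine Function.Injective.of_comp (f := Subtype.val) ?_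
    exact IsFractionRing.injective E (FractionRing E)
  have hint : (algebraMap E (integralClosure E (FractionRing E))).IsIntegral :=
    algebraMap_isIntegral_iff.mpr inferInstance
  exact ⟨integralClosure E (FractionRing E), inferInstance, inferInstance,
    integralClosure.isIntegrallyClosedOfFiniteExtension (FractionRing E), algebraMap _ _, hinj,
    hint.isLocalHom hinj⟩

/-- For a prime `Q` of a Noetherian domain `D`, minimal over a nonzero principal ideal, contracting
a nonzero principal ideal of the integral closure of `D` localized at `Q` to `A` gives an integrally
closed primary ideal. -/
lemma exists_isPrimary_of_mem_minimalPrimes {D : Type} [CommRing D] [IsDomain D]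
    [IsNoetherianRing D] (f : A →+* D) {I : Ideal A} {x : A} {Q : Ideal D} {u v : D}
    (hu : u ≠ 0) (hx : f x ≠ 0) (hQ : Q ∈ (span {u}).minimalPrimes) (hv : v ∉ Q)
    (hI : ∀ i ∈ I, ∃ w, v * f i = f x * u * w) :
    ∃ q : Ideal A, q.IsPrimary ∧ q.IsIntClosed ∧ I ≤ q ∧ x ∉ q ∧ q ≤ Q.comap f := by
  have : Q.IsPrime := hQ.1.1
  have huQ : u ∈ Q := hQ.1.2 (mem_span_singleton_self u)
  let E := Localization.AtPrime Q
  have : IsDomain E := IsLocalization.isDomain_localization Q.primeCompl_le_nonZeroDivisors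
  obtain ⟨O, _, _, _, φ, hEO, _⟩ := exists_isIntegrallyClosed_of_isDomain E
  have hDE : Function.Injective (algebraMap D E) :=
    IsLocalization.injective E Q.primeCompl_le_nonZeroDivisors
  let e : D →+* O := φ.comp (algebraMap D E)
  have he : Function.Injective e := hEO.comp hDE
  have hunit {d : D} (hd : d ∉ Q) : IsUnit (e d) :=
    (IsLocalization.map_units E (⟨d, hd⟩ : Q.primeCompl)).map φ
  have hnonunit : ¬ IsUnit (e u) := fun h => by
    have h' : IsUnit (algebraMap D E u) := isUnit_of_map_unit φ _ h
    exact (IsLocalization.AtPrime.isUnit_to_map_iff E Q u).mp h' huQ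
  have hg : e (f x * u) ≠ 0 := by
    rw [Ne, map_eq_zero_iff e he]
    exact mul_ne_zero hx hu
  have hheight : Q.height ≤ 1 := height_le_one_of_isPrincipal_of_mem_minimalPrimes _ Q hQ
  have hrad {z : D} (hz : z ∈ Q) : ∃ k, e z ^ k ∈ span {e (f x * u)} := by
    have hmem : algebraMap D E z ∈ (span {algebraMap D E (f x * u)}).radical := by
      rw [radical_eq_sInf, mem_sInf]
      rintro 𝔩 ⟨hle, h𝔩⟩
      have hg𝔩 : f x * u ∈ 𝔩.comap (algebraMap D E) := hle (mem_span_singleton_self _)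
      have hlQ : 𝔩.comap (algebraMap D E) ≤ Q := by
        intro d hd
        by_contra hdQ
        exact h𝔩.ne_top (eq_top_of_isUnit_mem _ hd
          (IsLocalization.map_units E (⟨d, hdQ⟩ : Q.primeCompl)))
      have hbot : (⊥ : Ideal D) < 𝔩.comap (algebraMap D E) :=
        bot_lt_iff_ne_bot.mpr fun h => mul_ne_zero hx hu (by simpa [h] using hg𝔩)
      have hpr : (𝔩.comap (algebraMap D E)).IsPrime := h𝔩.comap _
      have heq : 𝔩.comap (algebraMap D E) = Q := by
        by_contra hne
        have h1 := height_add_one_le_of_lt_of_isPrime hbot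
        have h2 := height_add_one_le_of_lt_of_isPrime (lt_of_le_of_ne hlQ hne)
        have h3 : (1 : ℕ∞) ≤ (𝔩.comap (algebraMap D E)).height := le_trans (by simp) h1
        have h4 : (1 : ℕ∞) + 1 ≤ 1 := (add_le_add_left h3 1).trans (h2.trans hheight)
        exact absurd h4 (by decide)
      exact heq.symm.le hz
    obtain ⟨k, hk⟩ := hmem
    refine ⟨k, ?_⟩
    have := mem_map_of_mem φ hk
    rwa [map_span, Set.image_singleton, map_pow] at this
  have hxq : x ∉ (span {e (f x * u)}).comap (e.comp f) := by
    intro h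
    obtain ⟨w, hw⟩ := mem_span_singleton.mp (mem_comap.mp h)
    refine hnonunit (IsUnit.of_mul_eq_one w ?_)
    have hx' : e (f x) ≠ 0 := by rwa [Ne, map_eq_zero_iff e he]
    refine mul_left_cancel₀ hx' ?_
    rw [map_mul] at hw
    rw [mul_one, ← mul_assoc]
    exact hw.symm
  have hle : (span {e (f x * u)}).comap (e.comp f) ≤ Q.comap f := by
    intro z hz
    by_contra hzQ
    have h : span {e (f x * u)} = ⊤ := eq_top_of_isUnit_mem _ hz (hunit hzQ)
    exact hxq (mem_comap.mpr (h.symm ▸ Submodule.mem_top))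
  refine ⟨_, isPrimary_iff.mpr ⟨ne_of_mem_of_not_mem' Submodule.mem_top hxq |>.symm, ?_⟩,
    (isIntClosed_span_singleton hg).comap _, ?_, hxq, hle⟩
  · intro y z hyz
    by_cases hz : f z ∈ Q
    · right
      obtain ⟨k, hk⟩ := hrad hz
      exact ⟨k, by simpa using hk⟩
    · left
      rw [mem_comap, map_mul (e.comp f)] at hyz
      exact (mul_unit_mem_iff_mem _ (hunit hz)).mp hyz
  · intro i hi
    obtain ⟨w, hw⟩ := hI i hi
    have h : e v * e (f i) ∈ span {e (f x * u)} := by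
      rw [← map_mul, hw, map_mul e (f x * u)]
      exact mul_mem_right _ _ (mem_span_singleton_self _)
    exact (unit_mul_mem_iff_mem _ (hunit hv)).mp h

lemma pow_mul_pow_le_pow_mul_pow {I J : Ideal A} (h : I ≤ J) {a b a' b' : ℕ} (ha : a' ≤ a)
    (hab : a' + b' ≤ a + b) : I ^ a * J ^ b ≤ I ^ a' * J ^ b' := by
  obtain ⟨c, rfl⟩ := Nat.exists_eq_add_of_le ha
  rw [pow_add, mul_assoc]
  refine mul_mono_right ((mul_mono_left (pow_right_mono h c)).trans ?_)
  rw [← pow_add]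
  exact pow_le_pow_right (by omega)

open Polynomial in
/-- Bounds the coefficients of the subalgebra of `A[t][u]` generated by `u`, `x * t * u` and
`I * t`. -/
lemma coeff_coeff_mem_of_mem_adjoin {I : Ideal A} {x : A} {G : Set A} (hG : G ⊆ I) {f : A[X][X]}
    (hf : f ∈ Algebra.adjoin A
      ({X, C (C x * X) * X} ∪ (fun i => C (C i * X)) '' G : Set A[X][X])) (a b : ℕ) :
    (f.coeff a).coeff b ∈ I ^ (b - a) * (I ⊔ span {x}) ^ min a b := by
  have hIJ : I ≤ I ⊔ span {x} := le_sup_left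
  induction hf using Algebra.adjoin_induction generalizing a b with
  | mem f hf =>
    rcases hf with (rfl | rfl) | ⟨i, hi, rfl⟩
    · rw [coeff_X]
      split_ifs with ha
      · rw [coeff_one]
        split_ifs with hb
        · subst ha hb; simp
        · exact zero_mem _
      · simp
    · rw [coeff_C_mul, coeff_X]
      split_ifs with ha
      · rw [mul_one, coeff_C_mul, coeff_X]
        split_ifs with hb
        · subst ha hb
          simpa using mem_sup_right (mem_span_singleton_self x)
        · simp
      · simp
    · rw [coeff_C]
      split_ifs with ha
      · rw [coeff_C_mul, coeff_X]
        split_ifs with hb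
        · subst ha hb
          simpa using hG hi
        · simp
      · simp
  | algebraMap r =>
    rw [IsScalarTower.algebraMap_apply A A[X] A[X][X], algebraMap_eq, algebraMap_eq, coeff_C]
    split_ifs with ha
    · rw [coeff_C]
      split_ifs with hb
      · subst ha hb; simp
      · simp
    · simp
  | add f g _ _ hf hg =>
    rw [coeff_add, coeff_add]
    exact add_mem (hf a b) (hg a b)
  | mul f g _ _ hf hg =>
    rw [coeff_mul, finsetSum_coeff]
    refine Submodule.sum_mem _ fun p hp => ?_
    rw [coeff_mul]
    refine Submodule.sum_mem _ fun q hq => ?_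
    rw [Finset.HasAntidiagonal.mem_antidiagonal] at hp hq
    have h := mul_mem_mul (hf p.1 q.1) (hg p.2 q.2)
    rw [mul_mul_mul_comm, ← pow_add, ← pow_add] at h
    exact pow_mul_pow_le_pow_mul_pow hIJ (by omega) (by omega) h

lemma IsIntClosed.mul_mem_of_mul_pow_mem {I : Ideal A} (hI : I.IsIntClosed) {x s : A} {n : ℕ}
    (h : s * x ^ (n + 1) ∈ I * (I ⊔ span {x}) ^ n) : s * x ∈ I := by
  refine hI _ n ?_
  have hle : span {s} * (I ⊔ span {x}) ≤ I ⊔ span {s * x} := by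
    rw [Ideal.mul_sup, span_singleton_mul_span_singleton]
    exact sup_le_sup_right mul_le_right _
  have h1 : s ^ n * (s * x ^ (n + 1)) ∈ span {s} ^ n * (I * (I ⊔ span {x}) ^ n) :=
    mul_mem_mul (pow_mem_pow (mem_span_singleton_self s) n) h
  rw [mul_left_comm, ← mul_pow] at h1
  have h2 := mul_mono_right (pow_right_mono hle n) h1
  convert h2 using 1
  ring

lemma exists_isPrimary_of_le_isPrime {C : Type} [CommRing C] [IsNoetherianRing C] (f : A →+* C)
    {I : Ideal A} {x : A} {p 𝔐 : Ideal C} (hp : p.IsPrime) (h𝔐 : 𝔐.IsPrime) (hp𝔐 : p ≤ 𝔐) {u v : C}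
    (hu : u ∈ 𝔐) (hv : v ∉ 𝔐) (hup : u ∉ p) (hxp : f x ∉ p)
    (hI : ∀ i ∈ I, ∃ w, v * f i = f x * u * w) :
    ∃ q : Ideal A, q.IsPrimary ∧ q.IsIntClosed ∧ I ≤ q ∧ x ∉ q ∧ q ≤ 𝔐.comap f := by
  let π := Ideal.Quotient.mk p
  have hker : RingHom.ker π = p := mk_ker
  have h𝔐' : (𝔐.map π).IsPrime :=
    map_isPrime_of_surjective Ideal.Quotient.mk_surjective (by rwa [hker])
  have hcomap : (𝔐.map π).comap π = 𝔐 := by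
    rw [comap_map_of_surjective' π Ideal.Quotient.mk_surjective, hker, sup_eq_left]
    exact hp𝔐
  obtain ⟨Q, hQ, hQ𝔐⟩ := exists_minimalPrimes_le (I := span {π u}) (J := 𝔐.map π) <| by
    rw [span_singleton_le_iff_mem]
    exact mem_map_of_mem π hu
  have hQ' : Q.comap π ≤ 𝔐 := hcomap ▸ comap_mono hQ𝔐
  obtain ⟨q, hq1, hq2, hIq, hxq, hqQ⟩ := exists_isPrimary_of_mem_minimalPrimes
    (π.comp f) (I := I) (x := x) (u := π u) (v := π v)
    (by rwa [Ne, Quotient.eq_zero_iff_mem])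
    (by rwa [RingHom.comp_apply, Ne, Quotient.eq_zero_iff_mem]) hQ (fun h => hv (hQ' h)) <| by
      intro i hi
      obtain ⟨w, hw⟩ := hI i hi
      exact ⟨π w, by simp only [RingHom.comp_apply, ← map_mul, hw]⟩
  exact ⟨q, hq1, hq2, hIq, hxq, fun a ha => hQ' (hqQ ha)⟩

open Polynomial in
/-- An element `x` outside an integrally closed ideal `I` such that `I : x` is prime is separated
from `I` by an integrally closed primary ideal contained in `I : x`. -/
lemma IsIntClosed.exists_isPrimary_of_colon [IsNoetherianRing A] {I P : Ideal A}
    (hI : I.IsIntClosed) [P.IsPrime] {x : A} (hx : ∀ a, a * x ∈ I ↔ a ∈ P) :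
    ∃ q : Ideal A, q.IsPrimary ∧ q.IsIntClosed ∧ I ≤ q ∧ x ∉ q ∧ q ≤ P := by
  obtain ⟨G, hG⟩ := IsNoetherian.noetherian I
  have hGI : (G : Set A) ⊆ I := by rw [← hG]; exact subset_span
  let S : Set A[X][X] := {X, C (C x * X) * X} ∪ (fun i => C (C i * X)) '' (G : Set A)
  let 𝒞 := Algebra.adjoin A S
  have hSfin : S.Finite := by
    refine Set.Finite.union ?_ (G.finite_toSet.image _)
    simp
  have : IsNoetherianRing 𝒞 := isNoetherianRing_of_fg (Subalgebra.fg_def.mpr ⟨S, hSfin, rfl⟩)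
  let u : 𝒞 := ⟨X, Algebra.subset_adjoin (by simp [S])⟩
  let v : 𝒞 := ⟨C (C x * X) * X, Algebra.subset_adjoin (by simp [S])⟩
  have hit {i : A} (hi : i ∈ I) : C (C i * X) ∈ 𝒞 := by
    rw [← hG] at hi
    induction hi using Submodule.span_induction with
    | mem i hi => exact Algebra.subset_adjoin (Or.inr ⟨i, hi, rfl⟩)
    | zero => simp
    | add i j _ _ hi hj => simpa [add_mul] using add_mem hi hj
    | smul r i _ hi => simpa [Algebra.smul_def, mul_assoc] using 𝒞.smul_mem hi r
  let T : Submonoid 𝒞 := P.primeCompl.map (algebraMap A 𝒞) ⊔ Submonoid.powers v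
  have hdisj : Disjoint (span {u} : Set 𝒞) T := by
    rw [Set.disjoint_left]
    intro c hc hcT
    obtain ⟨_, ⟨s, hs, rfl⟩, _, ⟨n, rfl⟩, rfl⟩ := Submonoid.mem_sup.mp hcT
    obtain ⟨d, hd⟩ := mem_span_singleton.mp (mul_mem_right v _ hc)
    have hd' := congrArg (fun f : 𝒞 => (f.1.coeff (n + 1)).coeff (n + 1)) hd
    have hval : ((algebraMap A 𝒞 s * v ^ n * v : 𝒞) : A[X][X]) =
        C (C (s * x ^ (n + 1)) * X ^ (n + 1)) * X ^ (n + 1) := by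
      have : ((algebraMap A 𝒞 s : 𝒞) : A[X][X]) = C (C s) := rfl
      simp only [Subalgebra.coe_mul, Subalgebra.coe_pow, this, v, map_mul, map_pow]
      ring
    simp only [hval, Subalgebra.coe_mul, u, coeff_X_mul, coeff_C_mul, coeff_X_pow, if_true,
      mul_one] at hd'
    have hmem := coeff_coeff_mem_of_mem_adjoin hGI d.2 n (n + 1)
    rw [← hd'] at hmem
    exact hs ((hx s).mp (hI.mul_mem_of_mul_pow_mem (n := n) (by simpa using hmem)))
  obtain ⟨𝔐, h𝔐, hu𝔐, h𝔐T⟩ := exists_le_prime_disjoint _ T hdisj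
  have hv𝔐 : v ∉ 𝔐 := fun h => Set.disjoint_left.mp h𝔐T h
    (Submonoid.mem_sup_right (Submonoid.mem_powers v))
  have hP𝔐 {a : A} (ha : algebraMap A 𝒞 a ∈ 𝔐) : a ∈ P := by
    by_contra haP
    exact Set.disjoint_left.mp h𝔐T ha (Submonoid.mem_sup_left ⟨a, haP, rfl⟩)
  obtain ⟨p, hpmin, hp𝔐⟩ := exists_minimalPrimes_le (I := (⊥ : Ideal 𝒞)) (J := 𝔐) bot_le
  have hp : p.IsPrime := hpmin.1.1
  have hbot : (⊥ : Ideal A[X][X]).comap 𝒞.val.toRingHom = ⊥ :=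
    comap_bot_of_injective _ Subtype.val_injective
  obtain ⟨p', hp', -, hpp'⟩ :=
    exists_comap_eq_of_mem_minimalPrimes 𝒞.val.toRingHom p (by rwa [hbot])
  have hvp' : C (C x * X) * X ∉ p' := fun h => hv𝔐 (hp𝔐 (hpp' ▸ h))
  have hup : u ∉ p := fun h => hvp' (p'.mul_mem_left _ (by rw [← hpp'] at h; exact h))
  have hxp : algebraMap A 𝒞 x ∉ p := fun h => hvp' <| by
    rw [← hpp'] at h
    rw [C_mul, mul_assoc]
    exact p'.mul_mem_right _ h
  obtain ⟨q, hq1, hq2, hIq, hxq, hq𝔐⟩ := exists_isPrimary_of_le_isPrime (C := 𝒞)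
    (algebraMap A 𝒞) (x := x) (u := u) (v := v) hp h𝔐 hp𝔐
    (hu𝔐 (mem_span_singleton_self u)) hv𝔐 hup hxp (I := I) fun i hi => by
      refine ⟨⟨_, hit hi⟩, Subtype.ext ?_⟩
      change C (C x * X) * X * C (C i) = C (C x) * X * C (C i * X)
      simp only [C_mul]
      ring
  exact ⟨q, hq1, hq2, hIq, hxq, fun a ha => hP𝔐 (hq𝔐 ha)⟩

/-- In a Noetherian ring, an element outside of an ideal has a multiple whose colon ideal is
prime. -/
lemma exists_mul_colon_isPrime [IsNoetherianRing A] {I : Ideal A} {x : A} (hx : x ∉ I) :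
    ∃ c, ∃ P : Ideal A, P.IsPrime ∧ ∀ a, a * (c * x) ∈ I ↔ a ∈ P := by
  let M := Submodule.span A {Quotient.mk I x}
  have hM : (⟨_, Submodule.mem_span_singleton_self (Quotient.mk I x)⟩ : M) ≠ 0 := fun h =>
    hx (Quotient.eq_zero_iff_mem.mp (congrArg Subtype.val h))
  obtain ⟨P, hP, -⟩ := exists_le_isAssociatedPrime_of_isNoetherianRing A _ hM
  obtain ⟨hPprime, ⟨_, hm⟩, rfl⟩ := isAssociatedPrime_iff.mp hP
  obtain ⟨c, rfl⟩ := Submodule.mem_span_singleton.mp hm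
  refine ⟨c, _, hPprime, fun a => ?_⟩
  rw [Submodule.mem_colon_singleton, Submodule.mem_bot, ← Quotient.eq_zero_iff_mem,
    ← Submodule.coe_eq_zero]
  rfl

/-- An integrally closed ideal of a Noetherian ring is a finite intersection of integrally closed
primary ideals. -/
lemma IsIntClosed.exists_finset_inf_eq [IsNoetherianRing A] {I : Ideal A} (hI : I.IsIntClosed) :
    ∃ s : Finset (Ideal A), (∀ q ∈ s, q.IsPrimary ∧ q.IsIntClosed) ∧ s.inf id = I := by
  classical
  let 𝒮 : Set (Ideal A) := {L | I ≤ L ∧ ∃ s : Finset (Ideal A),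
    (∀ q ∈ s, (q.IsPrimary ∧ q.IsIntClosed) ∧ I ≤ q) ∧ L ⊓ s.inf id ≤ I}
  obtain ⟨L, ⟨hIL, s, hs, hLs⟩, hmax⟩ := set_has_maximal_iff_noetherian.mpr ‹_› 𝒮
    ⟨I, le_rfl, ∅, by simp, by simp⟩
  refine ⟨s, fun q hq => (hs q hq).1, le_antisymm ?_ (Finset.le_inf fun q hq => (hs q hq).2)⟩
  intro y hy
  by_contra hyI
  obtain ⟨c, P, hP, hcP⟩ := exists_mul_colon_isPrime hyI
  obtain ⟨q, hq, hqc, hIq, hxq, hqP⟩ := hI.exists_isPrimary_of_colon hcP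
  have hxI : c * y ∉ I := fun h => hxq (hIq h)
  have hxs : c * y ∈ s.inf id := mul_mem_left _ c hy
  have hxL : c * y ∉ L := fun h => hxI (hLs ⟨h, hxs⟩)
  refine hmax (L ⊔ span {c * y}) ⟨hIL.trans le_sup_left, insert q s, ?_, ?_⟩
    (left_lt_sup.mpr fun h => hxL (h (mem_span_singleton_self _)))
  · simpa using ⟨⟨⟨hq, hqc⟩, hIq⟩, hs⟩
  · rintro z ⟨hz, hzq⟩
    rw [Finset.inf_insert] at hzq
    obtain ⟨l, hl, w, hw, rfl⟩ := Submodule.mem_sup.mp hz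
    obtain ⟨a, rfl⟩ := mem_span_singleton'.mp hw
    have hlI : l ∈ I := by
      refine hLs ⟨hl, ?_⟩
      simpa using sub_mem hzq.2 (mul_mem_left _ a hxs)
    refine add_mem hlI ((hcP a).mpr ?_)
    have haq : c * y * a ∈ q := by
      simpa [mul_comm] using sub_mem hzq.1 (hIq hlI)
    exact hP.radical_le_iff.mpr hqP (((isPrimary_iff.mp hq).2 haq).resolve_left hxq)

lemma pow_mul_sup_pow_mul_pow_le {I Y W : Ideal A} (n a b : ℕ)
    (h : ∀ i j, a ≤ i → i + j = a + n + b → I ^ i * Y ^ j ≤ W) :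
    I ^ a * (I ⊔ Y) ^ n * Y ^ b ≤ W := by
  induction n generalizing a b with
  | zero => simpa using h a b le_rfl (by omega)
  | succ n ih =>
    have heq : I ^ a * (I ⊔ Y) ^ (n + 1) * Y ^ b =
        I ^ (a + 1) * (I ⊔ Y) ^ n * Y ^ b ⊔ I ^ a * (I ⊔ Y) ^ n * Y ^ (b + 1) := by
      rw [← Submodule.add_eq_sup, ← Submodule.add_eq_sup]
      ring
    rw [heq]
    exact sup_le (ih _ _ fun i j hi hij => h i j (by omega) (by omega))
      (ih _ _ fun i j hi hij => h i j hi (by omega))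

variable {N : Type} [AddCommGroup N] [Module A N]

lemma RelIntDep.of_pow_mem {I : Ideal A} {y : A} {n : ℕ}
    (hy : y ^ (n + 1) ∈ I * (I ⊔ span {y}) ^ n ⊔ Module.annihilator A N) : I.RelIntDep N y := by
  refine ⟨n + 1, n.succ_pos, fun m => ?_⟩
  set U : Submodule A N :=
    ⨆ i ∈ Finset.Icc 1 (n + 1), y ^ (n + 1 - i) • (I ^ i • (⊤ : Submodule A N))
  have hle : I ^ 1 * (I ⊔ span {y}) ^ n * span {y} ^ 0 ≤ U.colon Set.univ := by
    refine pow_mul_sup_pow_mul_pow_le _ _ _ fun i j hi hij => ?_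
    rw [span_singleton_pow, Ideal.mul_le]
    rintro r hr s hs
    obtain ⟨c, rfl⟩ := mem_span_singleton'.mp hs
    rw [Submodule.mem_colon]
    intro m _
    obtain rfl : j = n + 1 - i := by omega
    refine (le_biSup (fun i => y ^ (n + 1 - i) • (I ^ i • (⊤ : Submodule A N)))
      (Finset.mem_Icc.mpr ⟨hi, by omega⟩)) ?_
    have hmem : r • c • m ∈ I ^ i • (⊤ : Submodule A N) :=
      Submodule.smul_mem_smul hr Submodule.mem_top
    have := Submodule.smul_mem_pointwise_smul _ (y ^ (n + 1 - i)) _ hmem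
    convert this using 1
    simp only [smul_smul]
    congr 1
    ring
  obtain ⟨z, hz, w, hw, hzw⟩ := Submodule.mem_sup.mp hy
  rw [← hzw, add_smul, Module.mem_annihilator.mp hw, add_zero]
  exact Submodule.mem_colon.mp (hle (by simpa using hz)) m trivial

lemma RelIntDep.exists_pow_mem [IsNoetherian A N] {I : Ideal A} {y : A} (hy : I.RelIntDep N y) :
    ∃ n : ℕ, y ^ (n + 1) ∈ I * (I ⊔ span {y}) ^ n ⊔ Module.annihilator A N := by
  obtain ⟨n, hn, hy⟩ := hy
  obtain ⟨k, rfl⟩ := Nat.exists_eq_add_of_le' hn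
  set J := I ⊔ span {y}
  have hyJ : y ∈ J := mem_sup_right (mem_span_singleton_self y)
  have hy' : span {y} ^ (k + 1) • (⊤ : Submodule A N) ≤ (I * J ^ k) • ⊤ := by
    rw [span_singleton_pow, Submodule.ideal_span_singleton_smul]
    rintro _ ⟨m, -, rfl⟩
    refine (iSup₂_le fun i hi => ?_ : _ ≤ (I * J ^ k) • (⊤ : Submodule A N)) (hy m)
    rw [Finset.mem_Icc] at hi
    rw [← Submodule.ideal_span_singleton_smul, ← Submodule.mul_smul]
    refine Submodule.smul_mono_left ?_
    rw [mul_comm, ← span_singleton_pow]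
    calc I ^ i * span {y} ^ (k + 1 - i) ≤ I ^ i * J ^ (k + 1 - i) :=
          mul_mono_right (pow_right_mono le_sup_right _)
      _ ≤ I ^ 1 * J ^ k := pow_mul_pow_le_pow_mul_pow le_sup_left hi.1 (by omega)
      _ = I * J ^ k := by rw [pow_one]
  let N' : Submodule A N := J ^ k • ⊤
  have hJN : J ^ (k + 1) • (⊤ : Submodule A N) ≤ I • N' := by
    rw [← Submodule.mul_smul]
    refine (Submodule.smul_mono_left (sup_pow_succ_le _ _ _)).trans ?_
    rw [Submodule.sup_smul]
    exact sup_le le_rfl hy'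
  obtain ⟨p, hp, -, hpI, hp0⟩ :=
    LinearMap.exists_monic_and_natDegree_eq_and_coeff_mem_pow_and_aeval_eq_zero A
      (algebraMap A (Module.End A N') y) I <| by
    rintro _ ⟨m, rfl⟩
    rw [Submodule.mem_smul_top_iff]
    refine hJN ?_
    rw [pow_succ', Submodule.mul_smul]
    exact Submodule.smul_mem_smul hyJ m.2
  rw [Polynomial.aeval_algebraMap_apply_eq_algebraMap_eval] at hp0
  have hann : y ^ (k + 1) * p.eval y ∈ Module.annihilator A N := by
    rw [Module.mem_annihilator]
    intro m
    have hm : y ^ k • m ∈ N' := Submodule.smul_mem_smul (pow_mem_pow hyJ k) Submodule.mem_top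
    have h0 : p.eval y • y ^ k • m = 0 :=
      congrArg Subtype.val (LinearMap.congr_fun hp0 ⟨_, hm⟩)
    rw [pow_succ', mul_assoc, mul_comm (y ^ k), mul_smul, mul_smul, h0, smul_zero]
  refine ⟨k + p.natDegree, ?_⟩
  rw [Polynomial.eval_eq_sum_range, Finset.sum_range_succ, hp.coeff_natDegree, one_mul, mul_add,
    ← pow_add, Finset.mul_sum] at hann
  have hsum : ∑ i ∈ Finset.range p.natDegree, y ^ (k + 1) * (p.coeff i * y ^ i) ∈
      I * J ^ (k + p.natDegree) := by
    refine Submodule.sum_mem _ fun i hi => ?_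
    rw [Finset.mem_range] at hi
    rw [mul_left_comm, ← pow_add]
    have h := mul_mem_mul (hpI i) (pow_mem_pow hyJ (k + 1 + i))
    simpa using pow_mul_pow_le_pow_mul_pow (a' := 1) (b' := k + p.natDegree) le_sup_left
      (by omega) (by omega) h
  have h := sub_mem (mem_sup_right hann) (mem_sup_left hsum)
  rw [add_sub_cancel_left] at h
  rwa [add_right_comm]

end Ideal

lemma Module.isNoetherianRing_quotient_annihilator (R N : Type) [CommRing R] [AddCommGroup N]
    [Module R N] [IsNoetherian R N] : IsNoetherianRing (R ⧸ Module.annihilator R N) := by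
  obtain ⟨s, hs⟩ := IsNoetherian.noetherian (⊤ : Submodule R N)
  let φ : R →ₗ[R] (s → N) := LinearMap.pi fun i => LinearMap.toSpanSingleton R N i
  have hφ : Module.annihilator R N = LinearMap.ker φ := by
    ext r
    rw [← Submodule.annihilator_top, ← hs, Submodule.mem_annihilator_span, LinearMap.mem_ker,
      funext_iff]
    rfl
  rw [isNoetherianRing_iff, hφ]
  have : IsNoetherian R (R ⧸ LinearMap.ker φ) :=
    isNoetherian_of_injective (φ.range.subtype ∘ₗ φ.quotKerEquivRange.toLinearMap)
      (Subtype.val_injective.comp φ.quotKerEquivRange.injective)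
  exact isNoetherian_of_tower R this

/-- An ideal integrally closed relative to a Noetherian module `N` admits a primary
decomposition all of whose components are integrally closed relative to `N`. -/
theorem exists_primary_decomposition_relIntClosed {R : Type} [CommRing R] (N : Type)
    [AddCommGroup N] [Module R N] [IsNoetherian R N] (I : Ideal R)
    (hI : (I : Set R) = I.relIntClosure N) :
    ∃ (t : ℕ) (q : Fin t → Ideal R), (∀ i, (q i).IsPrimary) ∧ I = ⨅ i, q i ∧
      ∀ i, ((q i : Set R) = (q i).relIntClosure N) := by
  have : IsNoetherianRing (R ⧸ Module.annihilator R N) :=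
    Module.isNoetherianRing_quotient_annihilator R N
  let π := Ideal.Quotient.mk (Module.annihilator R N)
  have hsurj : Function.Surjective π := Ideal.Quotient.mk_surjective
  have hcomap (K : Ideal R) : (K.map π).comap π = K ⊔ Module.annihilator R N := by
    rw [Ideal.comap_map_of_surjective' π hsurj, Ideal.mk_ker]
  have hmem {y : R} (hy : I.RelIntDep N y) : y ∈ I := by
    rw [← SetLike.mem_coe, hI]
    exact hy
  have hann : Module.annihilator R N ≤ I := fun z hz =>
    hmem (Ideal.RelIntDep.of_pow_mem (n := 0) (Ideal.mem_sup_right (by simpa using hz)))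
  have hclosed : (I.map π).IsIntClosed := by
    intro y n hy
    obtain ⟨y, rfl⟩ := hsurj y
    refine Ideal.mem_map_of_mem π (hmem (Ideal.RelIntDep.of_pow_mem (n := n) ?_))
    rw [← hcomap, Ideal.mem_comap]
    simpa [Ideal.map_mul, Ideal.map_pow, Ideal.map_sup, Ideal.map_span] using hy
  obtain ⟨s, hs, hsI⟩ := hclosed.exists_finset_inf_eq
  refine ⟨s.card, fun i => (s.equivFin.symm i : Ideal _).comap π,
    fun i => (hs _ (s.equivFin.symm i).2).1.comap π, ?_, fun i => Set.Subset.antisymm ?_ ?_⟩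
  · have hinf : ⨅ i, (s.equivFin.symm i : Ideal (R ⧸ Module.annihilator R N)) = I.map π := by
      rw [← hsI, Finset.inf_eq_iInf, iInf_subtype']
      exact s.equivFin.symm.iInf_comp (g := Subtype.val)
    rw [← Ideal.comap_iInf, hinf, hcomap, sup_eq_left.mpr hann]
  · intro y hy
    exact Ideal.RelIntDep.of_pow_mem (n := 0) (Ideal.mem_sup_left (by simpa using hy))
  · intro y hy
    obtain ⟨n, hn⟩ := Ideal.RelIntDep.exists_pow_mem hy
    refine (hs _ (s.equivFin.symm i).2).2 (π y) n ?_
    rw [← hcomap, Ideal.mem_comap, map_pow] at hn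
    exact Ideal.map_comap_mul_pow_le π _ y n hn
end

section
/- Let R be a commutative ring (not necessarily Noetherian), N a Noetherian R-module, and I an ideal of R that is not contained in any minimal prime ideal over Ann_R N. Then for all integers n ≥ m ≥ 0 one has ((I^n)^{(N)}_a :_R I^m) = ((I^n)^{(N)}_a :_R (I^m)_a) = ((I^n)^{(N)}_a :_R (I^m)^{(N)}_a) = (I^{n-m})^{(N)}_a. -/
open Pointwise

namespace Ideal

variable {R : Type} [CommRing R] {N : Type} [AddCommGroup N] [Module R N]

theorem iSup_pow_smul_pow_smul_top (I : Ideal R) (x : R) (n : ℕ) :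
    (⨆ i ∈ Finset.Icc 1 (n + 1), x ^ (n + 1 - i) • (I ^ i • (⊤ : Submodule R N))) =
      (I * (I ⊔ span {x}) ^ n) • (⊤ : Submodule R N) := by
  apply le_antisymm
  · refine iSup₂_le fun i hi => ?_
    obtain ⟨h1, h2⟩ := Finset.mem_Icc.mp hi
    obtain ⟨i, rfl⟩ := Nat.exists_eq_add_of_le' h1
    rw [← Submodule.ideal_span_singleton_smul, ← Submodule.mul_smul]
    refine Submodule.smul_mono_left ?_
    have h3 : n = n + 1 - (i + 1) + i := by omega
    rw [pow_succ' I i, mul_left_comm, ← span_singleton_pow]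
    refine Ideal.mul_mono_right ?_
    conv_rhs => rw [h3, pow_add]
    exact Ideal.mul_mono (Ideal.pow_right_mono le_sup_right _)
      (Ideal.pow_right_mono le_sup_left _)
  · rw [← Submodule.add_eq_sup, add_pow, Finset.mul_sum, Finset.sum_smul]
    refine Finset.sum_induction _ (· ≤ _) (fun _ _ => sup_le) bot_le fun i hi => ?_
    have hi' := Finset.mem_range.mp hi
    refine le_trans ?_ (le_iSup₂ (i + 1) (Finset.mem_Icc.mpr ⟨by omega, by omega⟩))
    rw [← Submodule.ideal_span_singleton_smul, ← Submodule.mul_smul]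
    refine Submodule.smul_mono_left ?_
    rw [← mul_assoc]
    refine Ideal.mul_le_left.trans (le_of_eq ?_)
    rw [← mul_assoc, ← pow_succ', span_singleton_pow, mul_comm, Nat.add_sub_add_right]

theorem relIntDep_iff (I : Ideal R) (x : R) :
    I.RelIntDep N x ↔ ∃ n : ℕ, ∀ y : N,
      x ^ (n + 1) • y ∈ (I * (I ⊔ span {x}) ^ n) • (⊤ : Submodule R N) := by
  constructor
  · rintro ⟨n, hn, h⟩
    obtain ⟨n, rfl⟩ := Nat.exists_eq_add_of_le' hn
    exact ⟨n, fun y => iSup_pow_smul_pow_smul_top (N := N) I x n ▸ h y⟩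
  · rintro ⟨n, h⟩
    exact ⟨n + 1, n.succ_pos, fun y => (iSup_pow_smul_pow_smul_top (N := N) I x n).symm ▸ h y⟩

theorem sup_span_singleton_pow_succ_le (I : Ideal R) (x : R) (n : ℕ) :
    (I ⊔ span {x}) ^ (n + 1) ≤ span {x ^ (n + 1)} ⊔ I * (I ⊔ span {x}) ^ n := by
  induction n with
  | zero => simp [sup_comm]
  | succ n ih =>
    rw [pow_succ' _ (n + 1), Ideal.sup_mul]
    refine sup_le le_sup_right ((Ideal.mul_mono_right ih).trans ?_)
    rw [Ideal.mul_sup, span_singleton_mul_span_singleton, ← pow_succ']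
    refine sup_le_sup_left ?_ _
    rw [mul_left_comm, pow_succ' _ n]
    exact Ideal.mul_mono_right (Ideal.mul_mono_left le_sup_right)

/-- If `x` is integral over `I` relative to `N`, then `x` maps `Q N` into `I Q N` for some ideal
`Q` containing a power of `I`. -/
theorem RelIntDep.exists_smul_le {I : Ideal R} {x : R} (h : I.RelIntDep N x) :
    ∃ (Q : Ideal R) (t : ℕ), I ^ t ≤ Q ∧
      (span {x} * Q) • (⊤ : Submodule R N) ≤ (I * Q) • ⊤ := by
  obtain ⟨n, hn⟩ := (relIntDep_iff I x).mp h
  refine ⟨(I ⊔ span {x}) ^ n, n, Ideal.pow_right_mono le_sup_left _, ?_⟩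
  have h1 : span {x} * (I ⊔ span {x}) ^ n ≤
      span {x ^ (n + 1)} ⊔ I * (I ⊔ span {x}) ^ n := by
    refine le_trans ?_ (sup_span_singleton_pow_succ_le I x n)
    rw [pow_succ']
    exact Ideal.mul_mono_left le_sup_right
  refine (Submodule.smul_mono_left h1).trans ?_
  rw [Submodule.sup_smul]
  refine sup_le ?_ le_rfl
  rw [Submodule.ideal_span_singleton_smul]
  rintro _ ⟨y, -, rfl⟩
  exact hn y

theorem pow_succ_sub_pow_succ_mem {I K : Ideal R} {d : ℕ} {a b : R} (hIK : I ≤ K)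
    (hb : b ∈ K ^ (d + 1)) (hab : a - b ∈ I * K ^ d) (j : ℕ) :
    a ^ (j + 1) - b ^ (j + 1) ∈ I * K ^ (d + (d + 1) * j) := by
  have ha : a ∈ K ^ (d + 1) := by
    rw [← sub_add_cancel a b]
    refine add_mem ?_ hb
    rw [pow_succ']
    exact Ideal.mul_mono_left hIK hab
  induction j with
  | zero => simpa using hab
  | succ j ih =>
    have h1 : a ^ (j + 2) - b ^ (j + 2) =
      (a - b) * a ^ (j + 1) + (a ^ (j + 1) - b ^ (j + 1)) * b := by ring
    rw [h1]
    refine add_mem ?_ ?_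
    · rw [pow_add, ← mul_assoc, pow_mul]
      exact Ideal.mul_mem_mul hab (Ideal.pow_mem_pow ha _)
    · rw [mul_add_one, ← add_assoc, pow_add, ← mul_assoc]
      exact Ideal.mul_mem_mul ih hb

/-- Determinant trick: if `x` maps `Q N` into `I Q N` and every annihilator of `Q N` is nilpotent
modulo the annihilator of `N`, then `x` is integral over `I` relative to `N`. -/
theorem relIntDep_of_smul_le [IsNoetherian R N] {I Q : Ideal R} {x : R}
    (h : (span {x} * Q) • (⊤ : Submodule R N) ≤ (I * Q) • ⊤)
    (hQ : (Q • (⊤ : Submodule R N)).annihilator ≤ (Module.annihilator R N).radical) :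
    I.RelIntDep N x := by
  set M : Submodule R N := Q • ⊤
  have hxM : LinearMap.range (algebraMap R (Module.End R M) x) ≤ I • ⊤ := by
    rintro _ ⟨y, rfl⟩
    have h1 : x • (y : N) ∈ (I • ⊤ : Submodule R M).map M.subtype := by
      rw [Submodule.map_smul'', Submodule.map_subtype_top]
      rw [Submodule.mul_smul I] at h
      refine h ?_
      rw [Submodule.mul_smul]
      exact Submodule.smul_mem_smul (mem_span_singleton_self x) y.2
    obtain ⟨z, hz, hzy⟩ := h1
    obtain rfl : z = x • y := Subtype.ext hzy
    exact hz
  obtain ⟨p, hp, -, hc, hz⟩ :=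
    LinearMap.exists_monic_and_natDegree_eq_and_coeff_mem_pow_and_aeval_eq_zero R
      (algebraMap R (Module.End R M) x) I hxM
  set d := p.natDegree
  set e := x * p.eval x with he
  have h0 : p.eval x ∈ M.annihilator := by
    rw [Polynomial.aeval_algebraMap_apply, Polynomial.coe_aeval_eq_eval] at hz
    exact Submodule.mem_annihilator.mpr fun y hy =>
      congrArg Subtype.val (LinearMap.congr_fun hz ⟨y, hy⟩)
  obtain ⟨j, hj⟩ := hQ (M.annihilator.mul_mem_left x h0)
  set K := I ⊔ span {x}
  have hxK : x ∈ K := le_sup_right (a := I) (mem_span_singleton_self x)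
  have h2 : e - x ^ (d + 1) ∈ I * K ^ d := by
    rw [he, Polynomial.eval_eq_sum_range, Finset.sum_range_succ, hp.coeff_natDegree]
    have : x * (∑ i ∈ Finset.range d, p.coeff i * x ^ i + 1 * x ^ d) - x ^ (d + 1) =
        ∑ i ∈ Finset.range d, p.coeff i * x ^ (i + 1) := by
      rw [mul_add, Finset.mul_sum, one_mul, ← pow_succ', add_sub_cancel_right]
      exact Finset.sum_congr rfl fun i _ => by ring
    rw [this]
    refine Ideal.sum_mem _ fun i hi => ?_
    have hi' := Finset.mem_range.mp hi
    obtain ⟨k, hk⟩ := Nat.exists_eq_add_of_lt hi'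
    have h3 := hc i
    have h4 : I ^ (d - i) ≤ I * K ^ k := by
      rw [show d - i = k + 1 by omega, pow_succ']
      exact Ideal.mul_mono_right (Ideal.pow_right_mono le_sup_left _)
    rw [show d = k + (i + 1) by omega, pow_add, ← mul_assoc]
    exact Ideal.mul_mem_mul (h4 h3) (Ideal.pow_mem_pow hxK _)
  have h5 := pow_succ_sub_pow_succ_mem (le_sup_left : I ≤ K) (Ideal.pow_mem_pow hxK _) h2 j
  refine (relIntDep_iff I x).mpr ⟨d + (d + 1) * j, fun y => ?_⟩
  have h6 : e ^ (j + 1) • y = 0 := by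
    rw [pow_succ', mul_smul, Module.mem_annihilator.mp hj, smul_zero]
  have h7 := Submodule.smul_mem_smul h5 (Submodule.mem_top (x := y))
  rw [sub_smul, h6, zero_sub, Submodule.neg_mem_iff, ← pow_mul] at h7
  rwa [show d + (d + 1) * j + 1 = (d + 1) * (j + 1) by ring]

theorem annihilator_smul_top_le_radical {I Q : Ideal R} {t : ℕ}
    (hI : ∀ p ∈ (Module.annihilator R N).minimalPrimes, ¬ I ≤ p) (hQ : I ^ t ≤ Q) :
    (Q • (⊤ : Submodule R N)).annihilator ≤ (Module.annihilator R N).radical := by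
  intro c hc
  rw [← Ideal.sInf_minimalPrimes, Submodule.mem_sInf]
  intro p hp
  have := hp.1.1
  have h1 : span {c} * I ^ t ≤ p := by
    refine le_trans ?_ hp.1.2
    refine Ideal.mul_le.mpr fun a ha b hb => Module.mem_annihilator.mpr fun y => ?_
    obtain ⟨r, rfl⟩ := mem_span_singleton'.mp ha
    rw [mul_smul, mul_smul, Submodule.mem_annihilator.mp hc _
      (Submodule.smul_mem_smul (hQ hb) Submodule.mem_top), smul_zero]
  rcases this.mul_le.mp h1 with h | h
  · exact h (mem_span_singleton_self c)
  · exact absurd (this.le_of_pow_le h) (hI p hp)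

theorem relIntDep_pow_iff [IsNoetherian R N] {I : Ideal R}
    (hI : ∀ p ∈ (Module.annihilator R N).minimalPrimes, ¬ I ≤ p) (s : ℕ) (x : R) :
    (I ^ s).RelIntDep N x ↔ ∃ (Q : Ideal R) (t : ℕ), I ^ t ≤ Q ∧
      (span {x} * Q) • (⊤ : Submodule R N) ≤ (I ^ s * Q) • ⊤ := by
  constructor
  · intro h
    obtain ⟨Q, t, hQ, h⟩ := h.exists_smul_le
    exact ⟨Q, s * t, by rwa [pow_mul], h⟩
  · rintro ⟨Q, t, hQ, h⟩
    exact relIntDep_of_smul_le h (annihilator_smul_top_le_radical hI hQ)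

theorem mul_mul_smul_top_le {A B C D P Q : Ideal R}
    (h : (A * P) • (⊤ : Submodule R N) ≤ (B * P) • ⊤)
    (h' : (C * Q) • (⊤ : Submodule R N) ≤ (D * Q) • ⊤) :
    (A * C * (P * Q)) • (⊤ : Submodule R N) ≤ (B * D * (P * Q)) • ⊤ := by
  have h1 := Submodule.smul_mono (le_refl (C * Q)) h
  have h2 := Submodule.smul_mono (le_refl (B * P)) h'
  simp only [← Submodule.mul_smul] at h1 h2
  rw [mul_mul_mul_comm A, mul_mul_mul_comm B, mul_comm (A * P)]
  rw [mul_comm (C * Q) (B * P)] at h1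
  exact h1.trans h2

theorem RelIntDep.mul_pow [IsNoetherian R N] {I : Ideal R}
    (hI : ∀ p ∈ (Module.annihilator R N).minimalPrimes, ¬ I ≤ p) {a b : ℕ} {x y : R}
    (hx : (I ^ a).RelIntDep N x) (hy : (I ^ b).RelIntDep N y) :
    (I ^ (a + b)).RelIntDep N (x * y) := by
  obtain ⟨P, s, hP, h1⟩ := (relIntDep_pow_iff hI _ _).mp hx
  obtain ⟨Q, t, hQ, h2⟩ := (relIntDep_pow_iff hI _ _).mp hy
  refine (relIntDep_pow_iff hI _ _).mpr ⟨P * Q, s + t, ?_, ?_⟩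
  · rw [pow_add]
    exact Ideal.mul_mono hP hQ
  · rw [pow_add, ← span_singleton_mul_span_singleton]
    exact mul_mul_smul_top_le h1 h2

theorem exists_finset_span_smul_top_eq [IsNoetherian R N] (J : Ideal R) :
    ∃ s : Finset R, (∀ y ∈ s, y ∈ J) ∧
      J • (⊤ : Submodule R N) = span (s : Set R) • ⊤ := by
  classical
  obtain ⟨_, ⟨s, hs, rfl⟩, hmax⟩ := set_has_maximal_iff_noetherian.mpr ‹IsNoetherian R N›
    {L | ∃ s : Finset R, (∀ y ∈ s, y ∈ J) ∧ L = span (s : Set R) • (⊤ : Submodule R N)}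
    ⟨_, ∅, by simp, rfl⟩
  refine ⟨s, hs, le_antisymm ?_ (Submodule.smul_mono_left (span_le.mpr hs))⟩
  refine Submodule.smul_le.mpr fun y hy z _ => ?_
  have h1 : span (s : Set R) • (⊤ : Submodule R N) ≤
      span ((insert y s : Finset R) : Set R) • ⊤ :=
    Submodule.smul_mono_left (span_mono (by simp))
  have h2 := hmax _ ⟨insert y s, by simpa [hy] using hs, rfl⟩
  rw [eq_of_le_of_not_lt h1 h2]
  exact Submodule.smul_mem_smul (subset_span (by simp)) Submodule.mem_top

theorem exists_forall_mem_finset_smul_le {I : Ideal R} {n : ℕ} {x : R} (s : Finset R)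
    (hs : ∀ y ∈ s, (I ^ n).RelIntDep N (x * y)) :
    ∃ (Q : Ideal R) (t : ℕ), I ^ t ≤ Q ∧
      (span {x} * span (s : Set R) * Q) • (⊤ : Submodule R N) ≤ (I ^ n * Q) • ⊤ := by
  classical
  induction s using Finset.induction_on with
  | empty => exact ⟨⊤, 0, le_top, by simp⟩
  | insert y s _ ih =>
    obtain ⟨P, t, hP, h1⟩ := ih fun z hz => hs z (Finset.mem_insert_of_mem hz)
    obtain ⟨Q, u, hQ, h2⟩ := (hs y (Finset.mem_insert_self _ _)).exists_smul_le
    refine ⟨Q * P, n * u + t, ?_, ?_⟩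
    · rw [pow_add, pow_mul]
      exact Ideal.mul_mono hQ hP
    · rw [Finset.coe_insert, span_insert, Ideal.mul_sup, Ideal.sup_mul, Submodule.sup_smul,
        span_singleton_mul_span_singleton]
      have h3 := mul_mul_smul_top_le h2 (le_refl ((1 * P) • (⊤ : Submodule R N)))
      have h4 := mul_mul_smul_top_le h1 (le_refl ((1 * Q) • (⊤ : Submodule R N)))
      rw [mul_one, mul_one] at h3 h4
      rw [mul_comm P Q] at h4
      exact sup_le h3 h4

theorem relIntDep_of_forall_mul_mem [IsNoetherian R N] {I : Ideal R}
    (hI : ∀ p ∈ (Module.annihilator R N).minimalPrimes, ¬ I ≤ p) {a b : ℕ} {x : R}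
    (hx : ∀ y ∈ I ^ b, (I ^ (a + b)).RelIntDep N (x * y)) : (I ^ a).RelIntDep N x := by
  obtain ⟨s, hs, hspan⟩ := exists_finset_span_smul_top_eq (N := N) (I ^ b)
  obtain ⟨Q, t, hQ, h⟩ := exists_forall_mem_finset_smul_le s fun y hy => hx y (hs y hy)
  refine (relIntDep_pow_iff hI _ _).mpr ⟨I ^ b * Q, b + t, ?_, ?_⟩
  · rw [pow_add]
    exact Ideal.mul_mono_right hQ
  · have h1 : (span {x} * (I ^ b * Q)) • (⊤ : Submodule R N) =
        (span {x} * span (s : Set R) * Q) • ⊤ := by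
      rw [mul_right_comm _ _ Q, mul_comm (I ^ b), ← mul_assoc, Submodule.mul_smul, hspan,
        ← Submodule.mul_smul]
    rw [h1, ← mul_assoc, ← pow_add]
    exact h

theorem subset_intClosure (I : Ideal R) : (I : Set R) ⊆ I.intClosure := by
  intro x hx
  refine ⟨1, one_pos, fun _ => -x, ?_, ?_⟩
  · intro i hi
    obtain rfl : i = 1 := by simpa using hi
    simpa using hx
  · simp

theorem intClosure_subset_relIntClosure (I : Ideal R) :
    I.intClosure ⊆ I.relIntClosure N := by
  rintro x ⟨n, hn, r, hr, h⟩
  refine ⟨n, hn, fun y => ?_⟩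
  rw [eq_neg_of_add_eq_zero_left h, neg_smul, Finset.sum_smul]
  refine neg_mem (Submodule.sum_mem _ fun i hi => ?_)
  refine Submodule.mem_iSup_of_mem i (Submodule.mem_iSup_of_mem hi ?_)
  rw [mul_comm, mul_smul]
  exact Submodule.smul_mem_pointwise_smul _ _ _
    (Submodule.smul_mem_smul (hr i hi) Submodule.mem_top)

end Ideal

theorem setColon_anti {R : Type} [CommRing R] (J : Set R) {K L : Set R} (h : K ⊆ L) :
    setColon J L ⊆ setColon J K :=
  fun _ hx y hy => hx y (h hy)

/-- Colon formulas for relative integral closures of powers: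
`((I^n)^{(N)}_a : I^m) = ((I^n)^{(N)}_a : (I^m)_a) = ((I^n)^{(N)}_a : (I^m)^{(N)}_a)
  = (I^{n-m})^{(N)}_a`. -/
theorem setColon_relIntClosure_pow {R : Type} [CommRing R] (N : Type) [AddCommGroup N]
    [Module R N] [IsNoetherian R N] (I : Ideal R)
    (hI : ∀ p ∈ (Module.annihilator R N).minimalPrimes, ¬ I ≤ p)
    (n m : ℕ) (hmn : m ≤ n) :
    setColon ((I ^ n).relIntClosure N) ((I ^ m : Ideal R) : Set R) =
        setColon ((I ^ n).relIntClosure N) ((I ^ m).intClosure) ∧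
    setColon ((I ^ n).relIntClosure N) ((I ^ m).intClosure) =
        setColon ((I ^ n).relIntClosure N) ((I ^ m).relIntClosure N) ∧
    setColon ((I ^ n).relIntClosure N) ((I ^ m).relIntClosure N) =
        (I ^ (n - m)).relIntClosure N := by
  have h1 := setColon_anti ((I ^ n).relIntClosure N) (I ^ m).subset_intClosure
  have h2 := setColon_anti ((I ^ n).relIntClosure N)
    ((I ^ m).intClosure_subset_relIntClosure (N := N))
  have hn : n - m + m = n := Nat.sub_add_cancel hmn
  have h3 : (I ^ (n - m)).relIntClosure N ⊆
      setColon ((I ^ n).relIntClosure N) ((I ^ m).relIntClosure N) := fun x hx y hy => by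
    have h := Ideal.RelIntDep.mul_pow hI hx hy
    rwa [hn] at h
  have h4 : setColon ((I ^ n).relIntClosure N) ((I ^ m : Ideal R) : Set R) ⊆
      (I ^ (n - m)).relIntClosure N := fun x hx =>
    Ideal.relIntDep_of_forall_mul_mem hI (b := m) fun y hy => by
      rw [hn]
      exact hx y hy
  exact ⟨(h4.trans (h3.trans h2)).antisymm h1, (h1.trans (h4.trans h3)).antisymm h2,
    (h2.trans (h1.trans h4)).antisymm h3⟩
end

section
/- Let R be a commutative ring (not necessarily Noetherian), N a Noetherian R-module, and I an ideal of R. Then the sequence of sets of associated primes Ass_R R/(I^n)^{(N)}_a, n = 1, 2, …, is increasing (Ass_R R/(I^n)^{(N)}_a ⊆ Ass_R R/(I^{n+1})^{(N)}_a for all n ≥ 1) and ultimately constant: there exists n_0 ≥ 1 such that Ass_R R/(I^n)^{(N)}_a = Ass_R R/(I^{n_0})^{(N)}_a for all n ≥ n_0. -/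
open Pointwise

section IntegralDependence

variable {A : Type} [CommRing A]

/-- `α = x ^ (t + 1) - k` for some `k ∈ K * (K + (x)) ^ t`: the value at `x` of a monic polynomial
of positive degree `d` whose coefficient of degree `i` lies in `K ^ (d - i)`. -/
def Ideal.IsMonicValue (K : Ideal A) (x α : A) : Prop :=
  ∃ t : ℕ, x ^ (t + 1) - α ∈ K * (K ⊔ Ideal.span {x}) ^ t

/-- `x` is integral over the ideal `K`. -/
def Ideal.IntDep (K : Ideal A) (x : A) : Prop :=
  ∃ t : ℕ, x ^ (t + 1) ∈ K * (K ⊔ Ideal.span {x}) ^ t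

/-- `L` is asymptotically contained in `K`: powers of `L` lie in powers of `K` with a bounded
shift of the exponents. -/
def Ideal.AsympLE (L K : Ideal A) : Prop :=
  ∃ m : ℕ, ∀ k : ℕ, L ^ (k + m) ≤ K ^ k

lemma Ideal.mem_sup_span_singleton_self (K : Ideal A) (x : A) : x ∈ K ⊔ Ideal.span {x} :=
  Ideal.mem_sup_right (Ideal.mem_span_singleton_self x)

lemma Ideal.IsMonicValue.mul {K : Ideal A} {x α β : A} (hα : K.IsMonicValue x α)
    (hβ : K.IsMonicValue x β) : K.IsMonicValue x (α * β) := by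
  obtain ⟨t, ht⟩ := hα
  obtain ⟨u, hu⟩ := hβ
  set J := K ⊔ Ideal.span {x}
  have hx : x ∈ J := K.mem_sup_span_singleton_self x
  have hKJ : K ≤ J := le_sup_left
  have hβJ : β ∈ J ^ (u + 1) := by
    have h1 : x ^ (u + 1) - β ∈ J ^ (u + 1) := by
      rw [pow_succ']
      exact Ideal.mul_mono_left hKJ hu
    have h2 := sub_mem (Ideal.pow_mem_pow hx (u + 1)) h1
    simpa using h2
  refine ⟨t + u + 1, ?_⟩
  have e : x ^ (t + u + 1 + 1) - α * β
      = (x ^ (u + 1) - β) * x ^ (t + 1) + (x ^ (t + 1) - α) * β := by ring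
  rw [e]
  refine add_mem ?_ ?_
  · have := Ideal.mul_mem_mul hu (Ideal.pow_mem_pow hx (t + 1))
    rwa [mul_assoc, ← pow_add, show u + (t + 1) = t + u + 1 by ring] at this
  · have := Ideal.mul_mem_mul ht hβJ
    rwa [mul_assoc, ← pow_add] at this

lemma Ideal.isMonicValue_self (K : Ideal A) (x : A) : K.IsMonicValue x x :=
  ⟨0, by simp⟩

lemma Ideal.IsMonicValue.pow {K : Ideal A} {x α : A} (hα : K.IsMonicValue x α) (e : ℕ) :
    K.IsMonicValue x (α ^ (e + 1)) := by
  induction e with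
  | zero => simpa using hα
  | succ e ih => rw [pow_succ]; exact ih.mul hα

lemma Ideal.IsMonicValue.intDep {K : Ideal A} {x α : A} (hα : K.IsMonicValue x α)
    (h : IsNilpotent α) : K.IntDep x := by
  obtain ⟨e, he⟩ := h
  obtain ⟨t, ht⟩ := hα.pow e
  exact ⟨t, by simpa [pow_succ, he] using ht⟩

lemma Ideal.intDep_of_isNilpotent (K : Ideal A) {x : A} (h : IsNilpotent x) : K.IntDep x :=
  (K.isMonicValue_self x).intDep h

lemma Ideal.IntDep.mem_of_le {K P : Ideal A} [P.IsPrime] {x : A} (h : K.IntDep x) (hKP : K ≤ P) :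
    x ∈ P := by
  obtain ⟨t, ht⟩ := h
  exact Ideal.IsPrime.mem_of_pow_mem ‹_› _ (hKP (Ideal.mul_le_left ht))

open Polynomial in
lemma Ideal.isMonicValue_mul_eval {K : Ideal A} {x : A} {p : A[X]} (hp : p.Monic)
    (hc : ∀ i, p.coeff i ∈ K ^ (p.natDegree - i)) : K.IsMonicValue x (x * p.eval x) := by
  refine ⟨p.natDegree, ?_⟩
  have hx := K.mem_sup_span_singleton_self x
  rw [Polynomial.eval_eq_sum_range, Finset.sum_range_succ, hp.coeff_natDegree]
  have e : x ^ (p.natDegree + 1) - x * (∑ i ∈ Finset.range p.natDegree, p.coeff i * x ^ i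
      + 1 * x ^ p.natDegree) = - ∑ i ∈ Finset.range p.natDegree, p.coeff i * x ^ (i + 1) := by
    rw [mul_add, Finset.mul_sum]
    have : ∀ i, x * (p.coeff i * x ^ i) = p.coeff i * x ^ (i + 1) := fun i => by ring
    simp only [this]
    ring
  rw [e]
  refine neg_mem (_root_.sum_mem fun i hi => ?_)
  rw [Finset.mem_range] at hi
  have h1 := hc i
  obtain ⟨d, hd⟩ := Nat.exists_eq_add_of_lt hi
  rw [show p.natDegree - i = d + 1 by omega, pow_succ'] at h1
  rw [show p.natDegree = d + (i + 1) by omega, pow_add, ← mul_assoc]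
  exact Ideal.mul_mem_mul (Ideal.mul_mono_right (Ideal.pow_right_mono le_sup_left d) h1)
    (Ideal.pow_mem_pow hx _)

lemma Ideal.exists_isMonicValue_smul_eq_zero {N : Type} [AddCommGroup N] [Module A N]
    {K : Ideal A} {x : A} {M : Submodule A N} (hM : M.FG) (h : ∀ m ∈ M, x • m ∈ K • M) :
    ∃ α, K.IsMonicValue x α ∧ ∀ m ∈ M, α • m = 0 := by
  have : Module.Finite A M := Module.Finite.iff_fg.mpr hM
  obtain ⟨p, hp, -, hc, h0⟩ :=
    LinearMap.exists_monic_and_natDegree_eq_and_coeff_mem_pow_and_aeval_eq_zero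
      A (algebraMap A (Module.End A M) x) K (by
        rintro _ ⟨m, rfl⟩
        rw [Submodule.mem_smul_top_iff]
        exact h m m.2)
  refine ⟨x * p.eval x, Ideal.isMonicValue_mul_eval hp hc, fun m hm => ?_⟩
  rw [Polynomial.aeval_algebraMap_apply] at h0
  have := congrArg (Subtype.val) (LinearMap.congr_fun h0 ⟨m, hm⟩)
  rw [mul_smul]
  simp only [Polynomial.coe_aeval_eq_eval, Module.algebraMap_end_apply, Submodule.coe_smul,
    LinearMap.zero_apply, ZeroMemClass.coe_zero] at this
  rw [this, smul_zero]

lemma Ideal.asympLE_sup {L L' K : Ideal A} (h : L.AsympLE K) (h' : L'.AsympLE K) :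
    (L ⊔ L').AsympLE K := by
  obtain ⟨m, hm⟩ := h
  obtain ⟨m', hm'⟩ := h'
  refine ⟨m + m', fun k => ?_⟩
  have key : ∀ (I : Ideal A) (m : ℕ), (∀ k, I ^ (k + m) ≤ K ^ k) → ∀ i, I ^ i ≤ K ^ (i - m) := by
    intro I m hI i
    rcases le_total m i with h | h
    · simpa [h] using hI (i - m)
    · simp [Nat.sub_eq_zero_of_le h]
  rw [← Submodule.add_eq_sup, add_pow]
  refine Finset.sum_induction _ (· ≤ K ^ k) (fun _ _ h1 h2 => sup_le h1 h2) bot_le fun i hi => ?_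
  rw [Finset.mem_range] at hi
  refine Ideal.mul_le_left.trans ?_
  refine (Ideal.mul_mono (key L m hm i) (key L' m' hm' _)).trans ?_
  rw [← pow_add]
  exact Ideal.pow_le_pow_right (by omega)

lemma Ideal.AsympLE.mono {L L' K : Ideal A} (h : L'.AsympLE K) (hL : L ≤ L') : L.AsympLE K :=
  h.imp fun _ hm k => (Ideal.pow_right_mono hL _).trans (hm k)

lemma Ideal.asympLE_refl (K : Ideal A) : K.AsympLE K := ⟨0, fun _ => le_rfl⟩

lemma Ideal.asympLE_span_singleton {x : A} {K : Ideal A} :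
    (Ideal.span {x}).AsympLE K ↔ ∃ m : ℕ, ∀ k : ℕ, x ^ (k + m) ∈ K ^ k := by
  simp [Ideal.AsympLE, Ideal.span_singleton_pow]

lemma Ideal.sup_span_singleton_pow_succ_le_s3 (K : Ideal A) (x : A) (t : ℕ) :
    (K ⊔ Ideal.span {x}) ^ (t + 1) ≤ K * (K ⊔ Ideal.span {x}) ^ t ⊔ Ideal.span {x ^ (t + 1)} := by
  induction t with
  | zero => simp
  | succ t ih =>
    set J := K ⊔ Ideal.span {x} with hJ
    have hx : x ∈ J := K.mem_sup_span_singleton_self x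
    rw [pow_succ']
    refine (Ideal.mul_mono_right ih).trans ?_
    rw [Ideal.mul_sup]
    refine sup_le ?_ ?_
    · refine le_trans (le_of_eq ?_) le_sup_left
      ring
    · rw [hJ, Ideal.sup_mul, Ideal.span_singleton_mul_span_singleton, ← pow_succ', ← hJ]
      refine sup_le_sup ?_ le_rfl
      exact Ideal.mul_mono_right
        ((Ideal.span_singleton_le_iff_mem _).mpr (Ideal.pow_mem_pow hx _))

lemma Ideal.IntDep.asympLE {x : A} {K : Ideal A} (h : K.IntDep x) :
    (Ideal.span {x}).AsympLE K := by
  obtain ⟨t, ht⟩ := h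
  set J := K ⊔ Ideal.span {x}
  have h1 : J ^ (t + 1) ≤ K * J ^ t := (K.sup_span_singleton_pow_succ_le_s3 x t).trans
    (sup_le le_rfl ((Ideal.span_singleton_le_iff_mem _).mpr ht))
  have h2 : ∀ k, J ^ (k + t) ≤ K ^ k * J ^ t := by
    intro k
    induction k with
    | zero => simp
    | succ k ih =>
      calc J ^ (k + 1 + t) = J * J ^ (k + t) := by ring
        _ ≤ J * (K ^ k * J ^ t) := Ideal.mul_mono_right ih
        _ = K ^ k * J ^ (t + 1) := by ring
        _ ≤ K ^ k * (K * J ^ t) := Ideal.mul_mono_right h1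
        _ = K ^ (k + 1) * J ^ t := by ring
  exact Ideal.AsympLE.mono ⟨t, fun k => (h2 k).trans Ideal.mul_le_left⟩ le_sup_right

section Noetherian

variable [IsNoetherianRing A]

lemma Ideal.AsympLE.exists_pow_succ_le {J K : Ideal A} (h : J.AsympLE K) (hKJ : K ≤ J) :
    ∃ j, J ^ (j + 1) ≤ K * J ^ j := by
  obtain ⟨m, hm⟩ := h
  let F : K.Filtration A :=
    { N := fun i => K ^ (i - m)
      mono := fun i => Ideal.pow_le_pow_right (by omega)
      smul_le := fun i => by
        rw [smul_eq_mul, ← pow_succ']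
        exact Ideal.pow_le_pow_right (by omega) }
  have hF : F.Stable := ⟨m, fun n hn => by
    change K • K ^ (n - m) = K ^ (n + 1 - m)
    rw [smul_eq_mul, ← pow_succ', Nat.sub_add_comm hn]⟩
  let F' : K.Filtration A :=
    { N := fun i => J ^ i
      mono := fun i => Ideal.pow_le_pow_right (by omega)
      smul_le := fun i => by
        rw [smul_eq_mul, pow_succ']
        exact Ideal.mul_mono_left hKJ }
  have hF' : F' ≤ F := fun i => by
    change J ^ i ≤ K ^ (i - m)
    rcases le_total m i with h | h
    · simpa [h] using hm (i - m)
    · simp [Nat.sub_eq_zero_of_le h]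
  obtain ⟨j, hj⟩ := hF.of_le hF'
  exact ⟨j, (hj j le_rfl).ge⟩

lemma Ideal.AsympLE.intDep {x : A} {K : Ideal A} (h : (Ideal.span {x}).AsympLE K) :
    K.IntDep x := by
  obtain ⟨j, hj⟩ := (Ideal.asympLE_sup K.asympLE_refl h).exists_pow_succ_le le_sup_left
  exact ⟨j, hj (Ideal.pow_mem_pow (K.mem_sup_span_singleton_self x) _)⟩

lemma Ideal.intDep_iff {x : A} {K : Ideal A} :
    K.IntDep x ↔ ∃ m : ℕ, ∀ k : ℕ, x ^ (k + m) ∈ K ^ k :=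
  ⟨fun h => Ideal.asympLE_span_singleton.mp h.asympLE,
    fun h => (Ideal.asympLE_span_singleton.mpr h).intDep⟩

lemma Ideal.asympLE_of_forall_intDep {L K : Ideal A} (h : ∀ x ∈ L, K.IntDep x) :
    L.AsympLE K := by
  induction L, L.fg_of_isNoetherianRing using Submodule.fg_induction with
  | singleton x => exact (h x (Ideal.mem_span_singleton_self x)).asympLE
  | sup L L' _ _ h1 h2 =>
    exact Ideal.asympLE_sup (h1 fun x hx => h x (Ideal.mem_sup_left hx))
      (h2 fun x hx => h x (Ideal.mem_sup_right hx))

lemma Ideal.IntDep.mul_left {x : A} {K : Ideal A} (h : K.IntDep x) (r : A) : K.IntDep (r * x) :=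
  (h.asympLE.mono ((Ideal.span_singleton_le_iff_mem _).mpr
    (Ideal.mul_mem_left _ r (Ideal.mem_span_singleton_self x)))).intDep

end Noetherian

end IntegralDependence

section AssociatedPrimes

variable {A : Type} [CommRing A]

lemma Ideal.exists_notMem_forall_mem {P : Ideal A} [P.IsPrime] {S : Set (Ideal A)}
    (hS : S.Finite) (h : ∀ Q ∈ S, ¬ Q ≤ P) : ∃ s, s ∉ P ∧ ∀ Q ∈ S, s ∈ Q := by
  have h1 : ¬ hS.toFinset.inf id ≤ P := by
    rw [Ideal.IsPrime.inf_le' ‹_›]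
    rintro ⟨Q, hQ, hQP⟩
    exact h Q (hS.mem_toFinset.mp hQ) hQP
  obtain ⟨s, hs, hsP⟩ := SetLike.not_le_iff_exists.mp h1
  refine ⟨s, hsP, fun Q hQ => ?_⟩
  exact (Finset.inf_le (f := id) (hS.mem_toFinset.mpr hQ)) hs

lemma isNilpotent_of_forall_mem_minimalPrimes {x : A} (h : ∀ p ∈ minimalPrimes A, x ∈ p) :
    IsNilpotent x := by
  rw [← mem_nilradical, nilradical, ← Ideal.sInf_minimalPrimes, Ideal.mem_sInf]
  exact fun {p} hp => h p hp

variable [IsNoetherianRing A]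

lemma Ideal.IntDep.add {K : Ideal A} {x y : A} (hx : K.IntDep x) (hy : K.IntDep y) :
    K.IntDep (x + y) :=
  ((Ideal.asympLE_sup hx.asympLE hy.asympLE).mono
    ((Ideal.span_singleton_le_iff_mem _).mpr (add_mem
      (Ideal.mem_sup_left (Ideal.mem_span_singleton_self x))
      (Ideal.mem_sup_right (Ideal.mem_span_singleton_self y))))).intDep

lemma mem_assQuot_of_mem_minimalPrimes {P K : Ideal A} (hP : P ∈ minimalPrimes A) (hK : K ≤ P) :
    P ∈ assQuot {x | K.IntDep x} := by
  have hPp : P.IsPrime := IsMinimalPrime.isPrime hP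
  obtain ⟨z, hzP, hz⟩ := Ideal.exists_notMem_forall_mem (P := P) (S := minimalPrimes A \ {P})
    ((minimalPrimes.finite_of_isNoetherianRing A).subset Set.sdiff_subset)
    (fun Q hQ hQP => hQ.2 (le_antisymm hQP (hP.2 hQ.1.1 hQP)))
  refine ⟨hPp, z, Set.ext fun r => ⟨fun hr => ?_, fun hr => ?_⟩⟩
  · refine K.intDep_of_isNilpotent (isNilpotent_of_forall_mem_minimalPrimes fun p hp => ?_)
    by_cases h : p = P
    · exact h ▸ P.mul_mem_right z hr
    · exact p.mul_mem_left r (hz p ⟨hp, h⟩)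
  · exact (hPp.mem_or_mem (Ideal.IntDep.mem_of_le hr hK)).resolve_right hzP

lemma Ideal.exists_notMem_forall_intDep {P K I : Ideal A} [P.IsPrime] {c : A}
    (h : ∀ d ∈ I, ∃ s ∉ P, K.IntDep (s * (d * c))) :
    ∃ s ∉ P, ∀ d ∈ I, K.IntDep (s * (d * c)) := by
  induction I, I.fg_of_isNoetherianRing using Submodule.fg_induction with
  | singleton x =>
    obtain ⟨s, hs, hx⟩ := h x (Ideal.mem_span_singleton_self x)
    refine ⟨s, hs, fun d hd => ?_⟩
    obtain ⟨r, rfl⟩ := Ideal.mem_span_singleton'.mp hd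
    rw [show s * (r * x * c) = r * (s * (x * c)) by ring]
    exact hx.mul_left r
  | sup L L' _ _ h1 h2 =>
    obtain ⟨s, hs, h1⟩ := h1 fun d hd => h d (Ideal.mem_sup_left hd)
    obtain ⟨s', hs', h2⟩ := h2 fun d hd => h d (Ideal.mem_sup_right hd)
    refine ⟨s * s', fun hmem => (Ideal.IsPrime.mem_or_mem ‹_› hmem).elim hs hs', fun d hd => ?_⟩
    obtain ⟨a, ha, b, hb, rfl⟩ := Submodule.mem_sup.mp hd
    rw [show s * s' * ((a + b) * c) = s' * (s * (a * c)) + s * (s' * (b * c)) by ring]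
    exact ((h1 a ha).mul_left s').add ((h2 b hb).mul_left s)

lemma Ideal.exists_isMonicValue_mul_pow_eq_zero {I : Ideal A} {n : ℕ} {y : A}
    (h : ∀ d ∈ I, (I ^ (n + 1)).IntDep (d * y)) :
    ∃ α, (I ^ n).IsMonicValue y α ∧ ∃ w, ∀ m ∈ I ^ w, α * m = 0 := by
  have h1 : (I * Ideal.span {y}).AsympLE (I ^ (n + 1)) := by
    refine Ideal.asympLE_of_forall_intDep fun x hx => ?_
    obtain ⟨d, hd, rfl⟩ := Ideal.mem_mul_span_singleton.mp hx
    exact h d hd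
  set J := I ^ n ⊔ Ideal.span {y} with hJ
  have hIJ : I ^ (n + 1) ⊔ I * Ideal.span {y} = I * J := by
    rw [hJ, Ideal.mul_sup, ← pow_succ']
  have h2 := Ideal.asympLE_sup (I ^ (n + 1)).asympLE_refl h1
  rw [hIJ] at h2
  obtain ⟨j, hj⟩ := h2.exists_pow_succ_le (hIJ ▸ le_sup_left)
  obtain ⟨α, hα, h0⟩ := Ideal.exists_isMonicValue_smul_eq_zero (K := I ^ n) (x := y)
    (M := I ^ (j + 1) * J ^ j) (Ideal.fg_of_isNoetherianRing _) (fun m hm => by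
      have : y * m ∈ J * (I ^ (j + 1) * J ^ j) :=
        Ideal.mul_mem_mul ((I ^ n).mem_sup_span_singleton_self y) hm
      rw [show J * (I ^ (j + 1) * J ^ j) = (I * J) ^ (j + 1) by ring] at this
      have := hj this
      rwa [show I ^ (n + 1) * (I * J) ^ j = I ^ n * (I ^ (j + 1) * J ^ j) by ring] at this)
  refine ⟨α, hα, j + 1 + n * j, fun m hm => h0 m ?_⟩
  rw [pow_add, pow_mul] at hm
  exact Ideal.mul_mono_right (Ideal.pow_right_mono le_sup_left j) hm

/-- The associated primes of the integral closures of the powers of an ideal of a Noetherian ring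
form an increasing sequence. -/
lemma assQuot_intDep_pow_subset (I : Ideal A) {n : ℕ} (hn : 1 ≤ n) :
    assQuot {x | (I ^ n).IntDep x} ⊆ assQuot {x | (I ^ (n + 1)).IntDep x} := by
  rintro P ⟨hP, c, hc⟩
  have hc' : ∀ r, r ∈ P ↔ (I ^ n).IntDep (r * c) := fun r => Set.ext_iff.mp hc r
  by_cases hmin : P ∈ minimalPrimes A ∧ I ≤ P
  · exact mem_assQuot_of_mem_minimalPrimes hmin.1 ((Ideal.pow_le_self n.succ_ne_zero).trans hmin.2)
  by_cases hd : ∃ d ∈ I, ∀ s, (I ^ (n + 1)).IntDep (s * (d * c)) → s ∈ P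
  · obtain ⟨d, hdI, hd⟩ := hd
    refine ⟨hP, d * c, Set.ext fun r => ⟨fun hr => ?_, hd r⟩⟩
    obtain ⟨m, hm⟩ := Ideal.intDep_iff.mp ((hc' r).mp hr)
    refine Ideal.intDep_iff.mpr ⟨m, fun k => ?_⟩
    rw [show (r * (d * c)) ^ (k + m) = (r * c) ^ (k + m) * d ^ (k + m) by ring, ← pow_mul,
      add_mul, one_mul, pow_add I, pow_mul]
    exact Ideal.mul_mem_mul (hm k)
      (Ideal.pow_le_pow_right (Nat.le_add_right k m) (Ideal.pow_mem_pow hdI _))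
  push Not at hd
  exfalso
  obtain ⟨s, hsP, hs⟩ := Ideal.exists_notMem_forall_intDep (P := P) (K := I ^ (n + 1)) (I := I)
    (c := c) (fun d hdI => (hd d hdI).imp fun _ h => ⟨h.2, h.1⟩)
  obtain ⟨s', hs'P, hs'⟩ := Ideal.exists_notMem_forall_mem (P := P)
    (S := {p ∈ minimalPrimes A | ¬ p ≤ P})
    ((minimalPrimes.finite_of_isNoetherianRing A).subset (Set.sep_subset _ _))
    (fun Q hQ => hQ.2)
  obtain ⟨α, hα, w, hw⟩ := Ideal.exists_isMonicValue_mul_pow_eq_zero (I := I) (n := n)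
    (y := s' * s * c) (fun d hdI => by
      rw [show d * (s' * s * c) = s' * (s * (d * c)) by ring]
      exact (hs d hdI).mul_left s')
  have hnil : IsNilpotent (s' * s * c * α) := by
    refine isNilpotent_of_forall_mem_minimalPrimes fun p hp => ?_
    have hpp : p.IsPrime := IsMinimalPrime.isPrime hp
    by_cases hpP : p ≤ P
    · by_cases hIp : I ≤ p
      · have hne : ¬ P ≤ p := fun h => hmin (le_antisymm h hpP ▸ ⟨hp, hIp⟩)
        obtain ⟨r, hrP, hrp⟩ := SetLike.not_le_iff_exists.mp hne
        have h1 := ((hc' r).mp hrP).mem_of_le ((Ideal.pow_le_self (by omega)).trans hIp)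
        exact p.mul_mem_right _ (p.mul_mem_left _ ((hpp.mem_or_mem h1).resolve_left hrp))
      · obtain ⟨g, hg, hgp⟩ := SetLike.not_le_iff_exists.mp hIp
        have h1 : α * g ^ w ∈ p := by rw [hw _ (Ideal.pow_mem_pow hg w)]; exact p.zero_mem
        exact p.mul_mem_left _ ((hpp.mem_or_mem h1).resolve_right
          fun h => hgp (hpp.mem_of_pow_mem _ h))
    · exact p.mul_mem_right _ (p.mul_mem_right _ (p.mul_mem_right _ (hs' p ⟨hp, hpP⟩)))
  have := (((I ^ n).isMonicValue_self _).mul hα).intDep hnil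
  exact (hP.mem_or_mem ((hc' _).mpr this)).elim hs'P hsP

end AssociatedPrimes

section Finiteness

lemma Module.exists_pow_smul_eq_zero_of_forall_mem_associatedPrimes {B M : Type} [CommRing B]
    [IsNoetherianRing B] [AddCommGroup M] [Module B M] {y : M} {s : B}
    (h : ∀ Q ∈ associatedPrimes B M, (∀ r : B, r • y = 0 → r ∈ Q) → s ∈ Q) :
    ∃ t : ℕ, s ^ t • y = 0 := by
  have hs : s ∈ ((⊥ : Submodule B M).colon {y}).radical := by
    rw [← Ideal.sInf_minimalPrimes, Ideal.mem_sInf]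
    intro Q hQ
    refine h Q ?_ fun r hr => hQ.1.2 (Submodule.mem_colon_singleton.mpr hr)
    exact isAssociatedPrime_iff.mpr
      ⟨hQ.1.1, Submodule.exists_eq_colon_of_mem_minimalPrimes hQ⟩
  obtain ⟨t, ht⟩ := hs
  exact ⟨t, Submodule.mem_colon_singleton.mp ht⟩

lemma Module.exists_pow_smul_eq_zero_uniform {B M : Type} [CommRing B] [AddCommGroup M]
    [Module B M] [IsNoetherian B M] (s : B) :
    ∃ T : ℕ, ∀ (y : M) (t : ℕ), s ^ t • y = 0 → s ^ T • y = 0 := by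
  obtain ⟨T, hT⟩ := (LinearMap.eventually_iSup_ker_pow_eq (algebraMap B (Module.End B M) s)).exists
  refine ⟨T, fun y t hy => ?_⟩
  have h1 : y ∈ LinearMap.ker (algebraMap B (Module.End B M) s ^ t) := by
    rw [LinearMap.mem_ker, ← map_pow]
    exact hy
  have h2 := hT ▸ (le_iSup (fun m => LinearMap.ker (algebraMap B (Module.End B M) s ^ m)) t) h1
  rw [LinearMap.mem_ker, ← map_pow] at h2
  exact h2

variable {A : Type} [CommRing A]

lemma Module.exists_notMem_pow_smul_eq_zero {B M : Type} [CommRing B] [IsNoetherianRing B]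
    [AddCommGroup M] [Module B M] [IsNoetherian B M] {f : A →+* B} {P : Ideal A} [P.IsPrime]
    (hP : P ∉ Ideal.comap f '' associatedPrimes B M) :
    ∃ s ∉ P, ∃ T : ℕ, ∀ (e : ℕ) (y : M), (∀ r ∈ P ^ e, f r • y = 0) → f s ^ T • y = 0 := by
  obtain ⟨s, hsP, hs⟩ := Ideal.exists_notMem_forall_mem (P := P)
    (S := {p ∈ Ideal.comap f '' associatedPrimes B M | ¬ p ≤ P})
    (((associatedPrimes.finite B M).image _).subset (Set.sep_subset _ _)) (fun Q hQ => hQ.2)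
  obtain ⟨T, hT⟩ := Module.exists_pow_smul_eq_zero_uniform (M := M) (f s)
  refine ⟨s, hsP, T, fun e y h => ?_⟩
  obtain ⟨t, ht⟩ := Module.exists_pow_smul_eq_zero_of_forall_mem_associatedPrimes (y := y)
    (s := f s) (fun Q hQ hQy => by
      have hQp : Q.IsPrime := hQ.1
      have hPQ : P ≤ Q.comap f :=
        Ideal.IsPrime.le_of_pow_le (n := e) fun r hr => hQy _ (h r hr)
      exact hs _ ⟨⟨Q, hQ, rfl⟩, fun hle => hP ⟨Q, hQ, le_antisymm hle hPQ⟩⟩)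
  exact hT y t ht

/-- The ideal `⨁ I ^ (i + 1) t ^ i` of the Rees algebra `⨁ I ^ i t ^ i`, with quotient the
associated graded ring of `I`. -/
def Ideal.reesShift (I : Ideal A) : Ideal (reesAlgebra I) where
  carrier := {f | ∀ i, (f : Polynomial A).coeff i ∈ I ^ (i + 1)}
  zero_mem' i := by simp
  add_mem' hf hg i := by
    simpa using add_mem (hf i) (hg i)
  smul_mem' g f hf i := by
    simp only [smul_eq_mul, MulMemClass.coe_mul, Polynomial.coeff_mul]
    refine _root_.sum_mem fun p hp => ?_
    rw [← Finset.HasAntidiagonal.mem_antidiagonal.mp hp, add_assoc, pow_add]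
    exact Ideal.mul_mem_mul (g.2 p.1) (hf p.2)

lemma Ideal.algebraMap_smul_mk_monomial_eq_zero {I : Ideal A} {j : ℕ} {a : A} (ha : a ∈ I ^ j)
    (r : A) : algebraMap A (reesAlgebra I) r • Ideal.Quotient.mk I.reesShift
      ⟨Polynomial.monomial j a, reesAlgebra.monomial_mem.mpr ha⟩ = 0 ↔ r * a ∈ I ^ (j + 1) := by
  rw [← Ideal.Quotient.mk_eq_mk, ← Submodule.Quotient.mk_smul, Submodule.Quotient.mk_eq_zero]
  have key : ∀ i, ((algebraMap A (reesAlgebra I) r • (⟨Polynomial.monomial j a,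
      reesAlgebra.monomial_mem.mpr ha⟩ : reesAlgebra I) : reesAlgebra I) : Polynomial A).coeff i
      = if j = i then r * a else 0 := by
    intro i
    rw [algebraMap_smul]
    simp [Polynomial.coeff_monomial]
  change (∀ i, _) ↔ _
  simp only [key]
  constructor
  · intro h
    simpa using h j
  · intro h i
    split_ifs with hi
    · exact hi ▸ h
    · exact zero_mem _

variable [IsNoetherianRing A]

set_option synthInstance.maxHeartbeats 200000 in
lemma Ideal.exists_notMem_pow_mul_mem (I : Ideal A) {P : Ideal A} [P.IsPrime]
    (hP : P ∉ Ideal.comap (algebraMap A (reesAlgebra I)) ''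
      associatedPrimes (reesAlgebra I) (reesAlgebra I ⧸ I.reesShift)) :
    ∃ s ∉ P, ∃ T : ℕ, ∀ (j e : ℕ) (a : A), a ∈ I ^ j → (∀ r ∈ P ^ e, r * a ∈ I ^ (j + 1)) →
      s ^ T * a ∈ I ^ (j + 1) := by
  obtain ⟨s, hsP, T, hT⟩ := Module.exists_notMem_pow_smul_eq_zero hP
  refine ⟨s, hsP, T, fun j e a ha h => ?_⟩
  refine (Ideal.algebraMap_smul_mk_monomial_eq_zero ha _).mp ?_
  rw [map_pow]
  exact hT e _ fun r hr => (Ideal.algebraMap_smul_mk_monomial_eq_zero ha r).mpr (h r hr)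

/-- The associated primes of the integral closures of the powers of an ideal `I` of a Noetherian
ring are contractions of associated primes of the associated graded ring of `I`. -/
lemma assQuot_intDep_pow_subset_image_comap (I : Ideal A) (n : ℕ) :
    assQuot {x | (I ^ n).IntDep x} ⊆ Ideal.comap (algebraMap A (reesAlgebra I)) ''
      associatedPrimes (reesAlgebra I) (reesAlgebra I ⧸ I.reesShift) := by
  rintro P ⟨hP, c, hc⟩
  have hc' : ∀ r, r ∈ P ↔ (I ^ n).IntDep (r * c) := fun r => Set.ext_iff.mp hc r
  by_contra hPG
  obtain ⟨s, hsP, T, hs⟩ := I.exists_notMem_pow_mul_mem hPG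
  have hiter : ∀ (l e : ℕ) (a : A), (∀ r ∈ P ^ e, r * a ∈ I ^ l) →
      ∀ j ≤ l, s ^ (T * j) * a ∈ I ^ j := by
    intro l e a h j hj
    induction j with
    | zero => simp
    | succ j ih =>
      rw [show s ^ (T * (j + 1)) * a = s ^ T * (s ^ (T * j) * a) by ring]
      refine hs j e _ (ih (by omega)) fun r hr => ?_
      rw [mul_left_comm]
      exact Ideal.mul_mem_left _ _ (Ideal.pow_le_pow_right hj (h r hr))
  obtain ⟨m, hm⟩ := Ideal.asympLE_of_forall_intDep (L := P * Ideal.span {c}) (K := I ^ n)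
    (fun x hx => by
      obtain ⟨d, hd, rfl⟩ := Ideal.mem_mul_span_singleton.mp hx
      exact (hc' d).mp hd)
  have : (I ^ n).IntDep (s ^ (T * n) * c) := by
    refine Ideal.intDep_iff.mpr ⟨m, fun k => ?_⟩
    have h1 := hiter (n * k) (k + m) (c ^ (k + m)) (fun r hr => by
      rw [pow_mul]
      refine hm k ?_
      rw [mul_pow, Ideal.span_singleton_pow]
      exact Ideal.mul_mem_mul hr (Ideal.mem_span_singleton_self _)) _ le_rfl
    rw [← pow_mul, mul_pow, ← pow_mul,
      show T * n * (k + m) = T * n * m + T * (n * k) by ring, pow_add, mul_assoc]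
    exact Ideal.mul_mem_left _ _ h1
  exact hsP (hP.mem_of_pow_mem _ ((hc' _).mpr this))

set_option synthInstance.maxHeartbeats 200000 in
lemma exists_finite_forall_assQuot_intDep_pow_subset (I : Ideal A) :
    ∃ X : Set (Ideal A), X.Finite ∧ ∀ n, assQuot {x | (I ^ n).IntDep x} ⊆ X :=
  ⟨_, (associatedPrimes.finite (reesAlgebra I) (reesAlgebra I ⧸ I.reesShift)).image _,
    assQuot_intDep_pow_subset_image_comap I⟩

end Finiteness

section Quotient

variable {R : Type} [CommRing R] {N : Type} [AddCommGroup N] [Module R N]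

lemma Ideal.span_singleton_mul_pow_le_iSup (K : Ideal R) (x : R) (t : ℕ) :
    K * (K ⊔ Ideal.span {x}) ^ t ≤
      ⨆ i ∈ Finset.Icc 1 (t + 1), Ideal.span {x ^ (t + 1 - i)} * K ^ i := by
  induction t with
  | zero => simp
  | succ t ih =>
    rw [pow_succ, ← mul_assoc]
    refine (Ideal.mul_mono_left ih).trans ?_
    simp only [Submodule.iSup_mul, iSup_le_iff, Ideal.mul_sup, sup_le_iff, Finset.mem_Icc]
    constructor
    · rintro i ⟨h1, h2⟩
      refine le_iSup₂_of_le (i + 1) ⟨by omega, by omega⟩ ?_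
      rw [mul_assoc, ← pow_succ, Nat.add_sub_add_right]
    · rintro i ⟨h1, h2⟩
      refine le_iSup₂_of_le i ⟨by omega, by omega⟩ ?_
      rw [mul_right_comm, Ideal.span_singleton_mul_span_singleton, ← pow_succ,
        Nat.sub_add_comm h2]

lemma Ideal.iSup_span_singleton_mul_pow_le (K : Ideal R) (x : R) (t : ℕ) :
    ⨆ i ∈ Finset.Icc 1 (t + 1), Ideal.span {x ^ (t + 1 - i)} * K ^ i ≤
      K * (K ⊔ Ideal.span {x}) ^ t := by
  refine iSup₂_le fun i hi => ?_
  rw [Finset.mem_Icc] at hi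
  obtain ⟨i, rfl⟩ := Nat.exists_eq_add_of_le' hi.1
  rw [← Ideal.span_singleton_pow, pow_succ', mul_left_comm]
  refine Ideal.mul_mono_right ?_
  refine (Ideal.mul_mono
    (Ideal.pow_right_mono (le_sup_right : Ideal.span {x} ≤ K ⊔ Ideal.span {x}) _)
    (Ideal.pow_right_mono (le_sup_left : K ≤ K ⊔ Ideal.span {x}) _)).trans ?_
  rw [← pow_add]
  exact Ideal.pow_le_pow_right (by omega)

lemma Ideal.relIntDep_iff_exists {K : Ideal R} {x : R} :
    K.RelIntDep N x ↔ ∃ t : ℕ, ∀ m : N,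
      x ^ (t + 1) • m ∈ (K * (K ⊔ Ideal.span {x}) ^ t) • (⊤ : Submodule R N) := by
  have key : ∀ t : ℕ, (K * (K ⊔ Ideal.span {x}) ^ t) • (⊤ : Submodule R N) =
      ⨆ i ∈ Finset.Icc 1 (t + 1), x ^ (t + 1 - i) • (K ^ i • (⊤ : Submodule R N)) := by
    intro t
    rw [le_antisymm (K.span_singleton_mul_pow_le_iSup x t) (K.iSup_span_singleton_mul_pow_le x t)]
    simp only [Submodule.iSup_smul, Submodule.mul_smul, Submodule.ideal_span_singleton_smul]
  simp only [key]
  constructor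
  · rintro ⟨n, hn, h⟩
    obtain ⟨t, rfl⟩ := Nat.exists_eq_add_of_lt hn
    exact ⟨t, by simpa only [zero_add] using h⟩
  · rintro ⟨t, h⟩
    exact ⟨t + 1, t.succ_pos, h⟩

variable [IsNoetherian R N]

lemma Ideal.relIntDep_iff_intDep_map {K : Ideal R} {x : R} : K.RelIntDep N x ↔
    (K.map (Ideal.Quotient.mk (Module.annihilator R N))).IntDep
      (Ideal.Quotient.mk (Module.annihilator R N) x) := by
  set φ := Ideal.Quotient.mk (Module.annihilator R N)
  have hmap : ∀ t : ℕ, K.map φ * (K.map φ ⊔ Ideal.span {φ x}) ^ t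
      = (K * (K ⊔ Ideal.span {x}) ^ t).map φ := by
    intro t
    rw [Ideal.map_mul, Ideal.map_pow, Ideal.map_sup, Ideal.map_span, Set.image_singleton]
  rw [Ideal.relIntDep_iff_exists]
  constructor
  · rintro ⟨t, h⟩
    set J := K ⊔ Ideal.span {x} with hJ
    have hx : x ∈ J := K.mem_sup_span_singleton_self x
    have h1 : J ^ (t + 1) • (⊤ : Submodule R N) ≤ (K * J ^ t) • ⊤ := by
      refine (Submodule.smul_mono_left (K.sup_span_singleton_pow_succ_le_s3 x t)).trans ?_
      rw [Submodule.sup_smul]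
      refine sup_le le_rfl ?_
      rw [Submodule.ideal_span_singleton_smul]
      rintro _ ⟨m, -, rfl⟩
      exact h m
    obtain ⟨α, ⟨u, hα⟩, h0⟩ := Ideal.exists_isMonicValue_smul_eq_zero (K := K) (x := x)
      (M := J ^ t • (⊤ : Submodule R N)) (IsNoetherian.noetherian _) (fun m hm => by
        rw [← Submodule.mul_smul]
        refine h1 ?_
        rw [pow_succ', Submodule.mul_smul]
        exact Submodule.smul_mem_smul hx hm)
    have hαφ : (K.map φ).IsMonicValue (φ x) (φ α) := by
      refine ⟨u, ?_⟩
      rw [hmap, ← map_pow, ← map_sub]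
      exact Ideal.mem_map_of_mem _ hα
    refine (((K.map φ).isMonicValue_self _).mul hαφ).intDep ⟨t + 1, ?_⟩
    have h2 : φ (α * x ^ t) = 0 := by
      rw [Ideal.Quotient.eq_zero_iff_mem, Module.mem_annihilator]
      intro m
      rw [mul_smul]
      exact h0 _ (Submodule.smul_mem_smul (Ideal.pow_mem_pow hx t) trivial)
    rw [← map_mul, ← map_pow, show (x * α) ^ (t + 1) = x * α ^ t * (α * x ^ t) by ring,
      map_mul, h2, mul_zero]
  · rintro ⟨t, ht⟩
    refine ⟨t, fun m => ?_⟩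
    rw [hmap, ← map_pow, Ideal.mem_map_iff_of_surjective _ Ideal.Quotient.mk_surjective] at ht
    obtain ⟨k, hk, hkx⟩ := ht
    have h1 := Module.mem_annihilator.mp (Ideal.Quotient.eq.mp hkx) m
    rw [sub_smul, sub_eq_zero] at h1
    rw [← h1]
    exact Submodule.smul_mem_smul hk trivial

variable (R N) in
lemma isNoetherianRing_quotient_annihilator :
    IsNoetherianRing (R ⧸ Module.annihilator R N) := by
  obtain ⟨s, hs⟩ := IsNoetherian.noetherian (⊤ : Submodule R N)
  let g : R →ₗ[R] s → N := LinearMap.pi fun n => LinearMap.toSpanSingleton R N n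
  have hker : LinearMap.ker g ≤ Module.annihilator R N := fun r hr => by
    have hle : (⊤ : Submodule R N) ≤ LinearMap.ker (LinearMap.lsmul R N r) := by
      rw [← hs, Submodule.span_le]
      exact fun n hn => congrFun hr ⟨n, hn⟩
    exact Module.mem_annihilator.mpr fun m => hle (Submodule.mem_top (x := m))
  have : IsNoetherian R (R ⧸ LinearMap.ker g) :=
    isNoetherian_of_linearEquiv g.quotKerEquivRange.symm
  have : IsNoetherian R (R ⧸ Module.annihilator R N) :=
    isNoetherian_of_surjective (Submodule.factor hker)
      (LinearMap.range_eq_top.mpr (Submodule.factor_surjective hker))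
  exact isNoetherian_of_tower R this

lemma assQuot_preimage {B : Type} [CommRing B] {φ : R →+* B} (hφ : Function.Surjective φ)
    {S : Set B} (h0 : 0 ∈ S) : assQuot (φ ⁻¹' S) = Ideal.comap φ '' assQuot S := by
  ext P
  constructor
  · rintro ⟨hP, x, hx⟩
    have hx' : ∀ r, r ∈ P ↔ φ (r * x) ∈ S := fun r => Set.ext_iff.mp hx r
    have hker : RingHom.ker φ ≤ P := fun r hr => by
      rw [hx', map_mul, (RingHom.mem_ker).mp hr, zero_mul]
      exact h0
    have hcomap : (P.map φ).comap φ = P := by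
      rw [Ideal.comap_map_of_surjective' φ hφ, sup_eq_left.mpr hker]
    refine ⟨P.map φ, ⟨Ideal.map_isPrime_of_surjective hφ hker, φ x, Set.ext fun b => ?_⟩, hcomap⟩
    obtain ⟨r, rfl⟩ := hφ b
    change φ r ∈ P.map φ ↔ φ r * φ x ∈ S
    rw [← map_mul, ← hx', ← Ideal.mem_comap, hcomap]
  · rintro ⟨Q, ⟨hQ, b, hb⟩, rfl⟩
    obtain ⟨x, rfl⟩ := hφ b
    refine ⟨Ideal.comap_isPrime φ Q, x, Set.ext fun r => ?_⟩
    change φ r ∈ (Q : Set B) ↔ φ (r * x) ∈ S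
    rw [hb, map_mul]
    rfl

lemma assQuot_relIntClosure (K : Ideal R) : assQuot (K.relIntClosure N) =
    Ideal.comap (Ideal.Quotient.mk (Module.annihilator R N)) ''
      assQuot {x | (K.map (Ideal.Quotient.mk (Module.annihilator R N))).IntDep x} := by
  rw [← assQuot_preimage Ideal.Quotient.mk_surjective (Ideal.intDep_of_isNilpotent _ .zero)]
  congr 1
  ext x
  exact Ideal.relIntDep_iff_intDep_map

end Quotient

/-- The sequence `Ass_R R/(I^n)^{(N)}_a`, `n ≥ 1`, is increasing and ultimately constant. -/
theorem assQuot_relIntClosure_pow_monotone_eventually_constant {R : Type} [CommRing R]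
    (N : Type) [AddCommGroup N] [Module R N] [IsNoetherian R N] (I : Ideal R) :
    (∀ n : ℕ, 1 ≤ n →
      assQuot ((I ^ n).relIntClosure N) ⊆ assQuot ((I ^ (n + 1)).relIntClosure N)) ∧
    ∃ n₀ : ℕ, 1 ≤ n₀ ∧ ∀ n : ℕ, n₀ ≤ n →
      assQuot ((I ^ n).relIntClosure N) = assQuot ((I ^ n₀).relIntClosure N) := by
  have hA : IsNoetherianRing (R ⧸ Module.annihilator R N) :=
    isNoetherianRing_quotient_annihilator R N
  set φ := Ideal.Quotient.mk (Module.annihilator R N)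
  have hn : ∀ n : ℕ, assQuot ((I ^ n).relIntClosure N) =
      Ideal.comap φ '' assQuot {x | ((I.map φ) ^ n).IntDep x} := fun n => by
    rw [assQuot_relIntClosure, Ideal.map_pow]
  have hmono : ∀ n : ℕ, 1 ≤ n →
      assQuot ((I ^ n).relIntClosure N) ⊆ assQuot ((I ^ (n + 1)).relIntClosure N) := fun n h1 => by
    rw [hn, hn]
    exact Set.image_mono (assQuot_intDep_pow_subset _ h1)
  refine ⟨hmono, ?_⟩
  obtain ⟨X, hX, hXn⟩ : ∃ X : Set (Ideal R), X.Finite ∧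
      ∀ n, assQuot ((I ^ n).relIntClosure N) ⊆ X := by
    obtain ⟨Y, hY, hYn⟩ := exists_finite_forall_assQuot_intDep_pow_subset (I.map φ)
    exact ⟨_, hY.image _, fun n => (hn n).trans_subset (Set.image_mono (hYn n))⟩
  have : Finite (Set.Iic X) := hX.finite_subsets
  obtain ⟨n, h⟩ := WellFoundedGT.monotone_chain_condition
    (⟨fun n => ⟨_, hXn (n + 1)⟩, monotone_nat_of_le_succ fun n => hmono (n + 1) (by omega)⟩ :
      ℕ →o Set.Iic X)
  refine ⟨n + 1, by omega, fun k hk => ?_⟩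
  obtain ⟨k, rfl⟩ := Nat.exists_eq_add_of_le' (show 1 ≤ k by omega)
  exact (congrArg Subtype.val (h k (by omega))).symm
end
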